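/- For every forest P and every threshold k ∈ ℤ+, there exists a forest P' with |P'| ≤ |P| and with at most 158k² red characters such that P and P' are ted^w_{≤k}-equivalent for every normalized quasimetric weight function w. -/

import Mathlib

open scoped NNReal ENNReal

attribute [local instance] Classical.propDecidable

/-- A labeled parenthesis over the alphabet `α`: `(true, a)` is the opening
parenthesis with label `a`, and `(false, a)` is the closing parenthesis. -/
abbrev Paren (α : Type*) := Bool × α

/-- Balanced strings of labeled parentheses (forests), following Definition 2.1:
the smallest set containing the empty string, closed under concatenation, and
containing `(_a · F · )_a` for every forest `F` and label `a`. -/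
inductive IsForest {α : Type*} : List (Paren α) → Prop
  | nil : IsForest []
  | append {F G : List (Paren α)} : IsForest F → IsForest G → IsForest (F ++ G)
  | wrap {F : List (Paren α)} (a : α) : IsForest F → IsForest ((true, a) :: F ++ [(false, a)])

/-- The fragment `l[i..j)` of a list. -/
def frag {β : Type*} (l : List β) (i j : ℕ) : List β := (l.take j).drop i

/-- `IsNode F i j` means that `[i..j]` is a node of the forest `F`: `F[i]` is an
opening parenthesis, `F[j]` is a closing parenthesis with the same label,
and `F(i..j)` is balanced. -/
def IsNode {α : Type*} (F : List (Paren α)) (i j : ℕ) : Prop :=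
  i < j ∧ j < F.length ∧ (∃ a : α, F[i]? = some (true, a) ∧ F[j]? = some (false, a)) ∧
    IsForest (frag F (i + 1) j)

/-- `MateRel F i j` holds when positions `i` and `j` are the paired parentheses
of a node of `F` (in either order); `j` is the mate of `i`. -/
def MateRel {α : Type*} (F : List (Paren α)) (i j : ℕ) : Prop :=
  IsNode F i j ∨ IsNode F j i

/-- A single edge of the alignment graph: horizontal, vertical, or diagonal. -/
def AlignStep (p q : ℕ × ℕ) : Prop :=
  q = (p.1 + 1, p.2) ∨ q = (p.1, p.2 + 1) ∨ q = (p.1 + 1, p.2 + 1)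

/-- An alignment of `X[x..x')` onto `Y[y..y')` is a path in the alignment graph
from `(x, y)` to `(x', y')`, interpreted as its sequence of vertices. -/
def IsAlignment (x x' y y' : ℕ) (path : List (ℕ × ℕ)) : Prop :=
  path.head? = some (x, y) ∧ path.getLast? = some (x', y') ∧ path.Chain' AlignStep

/-- The alignment (path) aligns character `f` of `X` to character `g` of `Y`
(a diagonal edge `(f, g) → (f + 1, g + 1)`). -/
def AlignsAt (path : List (ℕ × ℕ)) (f g : ℕ) : Prop :=
  ∃ t, path[t]? = some (f, g) ∧ path[t + 1]? = some (f + 1, g + 1)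

/-- The alignment deletes character `f` of `X` (a horizontal edge). -/
def DeletesAt (path : List (ℕ × ℕ)) (f : ℕ) : Prop :=
  ∃ t g, path[t]? = some (f, g) ∧ path[t + 1]? = some (f + 1, g)

/-- The alignment inserts character `g` of `Y` (a vertical edge). -/
def InsertsAt (path : List (ℕ × ℕ)) (g : ℕ) : Prop :=
  ∃ t f, path[t]? = some (f, g) ∧ path[t + 1]? = some (f, g + 1)

/-- Consistency condition of forest alignments (Definition 2.6): whenever the
alignment aligns `F[f]` to `G[g]`, it also aligns the mate of `F[f]` to the mate
of `G[g]`.  An alignment satisfying this condition is a forest alignment. -/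
def Consistent {α : Type*} (F G : List (Paren α)) (path : List (ℕ × ℕ)) : Prop :=
  ∀ f g f' g', AlignsAt path f g → MateRel F f f' → MateRel G g g' → AlignsAt path f' g'

/-- The width of the alignment is at most `m`: every vertex `(x, y)` on the path
satisfies `|x - y| ≤ m`. -/
def WidthLE (m : ℕ) (path : List (ℕ × ℕ)) : Prop :=
  ∀ p ∈ path, p.1 ≤ p.2 + m ∧ p.2 ≤ p.1 + m

/-- The label of the `i`-th character of `X` (as an element of `Σ ∪ {ε}`,
encoded by `Option α`; out-of-range positions give `ε`). -/
def lbl {α : Type*} (X : List (Paren α)) (i : ℕ) : Option α := (X[i]?).map Prod.snd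

/-- Cost of an alignment path with respect to the weight function `w̃(p, q) = ½·w(λ(p), λ(q))`:
horizontal edges cost `½·w(λ(X[x]), ε)`, vertical edges `½·w(ε, λ(Y[y]))`, and
diagonal edges `½·w(λ(X[x]), λ(Y[y]))`. -/
noncomputable def pathCost {α : Type*} (w : Option α → Option α → ℝ≥0)
    (X Y : List (Paren α)) : List (ℕ × ℕ) → ℝ≥0
  | [] => 0
  | [_] => 0
  | p :: q :: rest =>
      (if q.1 = p.1 + 1 ∧ q.2 = p.2 then (1 / 2 : ℝ≥0) * w (lbl X p.1) none
       else if q.1 = p.1 ∧ q.2 = p.2 + 1 then (1 / 2 : ℝ≥0) * w none (lbl Y p.2)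
       else (1 / 2 : ℝ≥0) * w (lbl X p.1) (lbl Y p.2)) + pathCost w X Y (q :: rest)

/-- A weight function `w : (Σ ∪ {ε})² → ℝ≥0` is normalized if `w(a, a) = 0` and
`w(a, b) ≥ 1` for distinct `a, b`. -/
def Normalized {α : Type*} (w : Option α → Option α → ℝ≥0) : Prop :=
  (∀ a, w a a = 0) ∧ ∀ a b, a ≠ b → 1 ≤ w a b

/-- A weight function satisfies the triangle inequality (is a quasimetric). -/
def Quasimetric {α : Type*} (w : Option α → Option α → ℝ≥0) : Prop :=
  ∀ a b c, w a c ≤ w a b + w b c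

/-- The weighted tree edit distance `ted^w(F[f..f'), G[g..g'))`: the minimum cost
of a forest alignment of the fragment `F[f..f')` onto the fragment `G[g..g')`
(`∞` if no forest alignment exists). -/
noncomputable def tedFrag {α : Type*} (w : Option α → Option α → ℝ≥0)
    (F G : List (Paren α)) (f f' g g' : ℕ) : ℝ≥0∞ :=
  ⨅ p : { p : List (ℕ × ℕ) // IsAlignment f f' g g' p ∧ Consistent F G p },
    (pathCost w F G p.1 : ℝ≥0∞)

/-- The bounded tree edit distance `bted_k^w(F[f..f'), G[g..g'))`: the minimum
cost of a forest alignment of width at most `2k` (`∞` if none exists). -/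
noncomputable def btedFrag {α : Type*} (k : ℕ) (w : Option α → Option α → ℝ≥0)
    (F G : List (Paren α)) (f f' g g' : ℕ) : ℝ≥0∞ :=
  ⨅ p : { p : List (ℕ × ℕ) //
      IsAlignment f f' g g' p ∧ Consistent F G p ∧ WidthLE (2 * k) p },
    (pathCost w F G p.1 : ℝ≥0∞)

/-- A string `S` over `P_Σ` is a periodic block (Definition 5.4): `|S| ≥ 42k` and
`S` has a string period of length at most `4k` containing equally many opening
and closing parentheses. -/
def IsPeriodicBlock {α : Type*} (k : ℕ) (S : List (Paren α)) : Prop :=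
  42 * k ≤ S.length ∧ ∃ p, 0 < p ∧ p ≤ 4 * k ∧
    (∀ i, i + p < S.length → S[i]? = S[i + p]?) ∧
    (S.take p).countP (fun c => c.1) = (S.take p).countP (fun c => !c.1)

/-- A character `T[i]` is black (Definition 5.5) if there exists a periodic block
`T[l..r)` of `T` such that `i ∈ [l + 5k..r − 5k)`; otherwise it is red. -/
def IsBlack {α : Type*} (k : ℕ) (T : List (Paren α)) (i : ℕ) : Prop :=
  ∃ l r, r ≤ T.length ∧ l + 5 * k ≤ i ∧ i + 5 * k < r ∧ IsPeriodicBlock k (frag T l r)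

/-- The number of red characters of `T`. -/
noncomputable def redCount {α : Type*} (k : ℕ) (T : List (Paren α)) : ℕ :=
  ((Finset.range T.length).filter fun i => ¬ IsBlack k T i).card

/-- The capped tree edit distance `ted^w_{≤k}(F, G)`: equal to `ted^w(F, G)` if the
latter is at most `k`, and `∞` otherwise. -/
noncomputable def tedLE {α : Type*} (k : ℕ) (w : Option α → Option α → ℝ≥0)
    (F G : List (Paren α)) : ℝ≥0∞ :=
  if tedFrag w F G 0 F.length 0 G.length ≤ (k : ℝ≥0∞) then
    tedFrag w F G 0 F.length 0 G.length
  else ⊤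

/-- Forests `P` and `P'` are `ted^w_{≤k}`-equivalent (Definition 5.8): for all forests
`F = F₁ · P · F₂` and `G = G₁ · P · G₂` with matching occurrences of `P` at positions
`l_F = |F₁|` and `l_G = |G₁|` satisfying `|l_F − l_G| ≤ 2k`, replacing both
occurrences of `P` by `P'` preserves `ted^w_{≤k}`. -/
def ForestEquiv {α : Type*} (k : ℕ) (w : Option α → Option α → ℝ≥0)
    (P P' : List (Paren α)) : Prop :=
  ∀ F1 F2 G1 G2 : List (Paren α),
    IsForest (F1 ++ P ++ F2) → IsForest (G1 ++ P ++ G2) →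
    F1.length ≤ G1.length + 2 * k → G1.length ≤ F1.length + 2 * k →
    tedLE k w (F1 ++ P ++ F2) (G1 ++ P ++ G2) = tedLE k w (F1 ++ P' ++ F2) (G1 ++ P' ++ G2)


/-! ### Part 1: forests, heights, mates -/

theorem forest_insert {α : Type*} {P : List (Paren α)} (hP : IsForest P) {Y : List (Paren α)}
    (hY : IsForest Y) : ∀ A B, Y = A ++ B → IsForest (A ++ P ++ B) := by
  induction hY with
  | nil =>
    intro A B h
    obtain ⟨rfl, rfl⟩ := List.append_eq_nil_iff.1 h.symm
    simpa using hP
  | @append F G hF hG ihF ihG =>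
    intro A B h
    rcases List.append_eq_append_iff.1 h with ⟨as, h1, h2⟩ | ⟨bs, h1, h2⟩
    · subst h1
      have := IsForest.append hF (ihG as B h2)
      simpa using this
    · subst h2
      have := IsForest.append (ihF A bs h1) hG
      simpa using this
  | @wrap F a hF ih =>
    intro A B h
    cases A with
    | nil =>
      have := IsForest.append hP (IsForest.wrap a hF)
      rw [h] at this
      simpa using this
    | cons c A =>
      simp only [List.cons_append, List.cons.injEq] at h
      obtain ⟨rfl, h⟩ := h
      rcases List.append_eq_append_iff.1 h with ⟨as, h1, h2⟩ | ⟨bs, h1, h2⟩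
      · subst h1
        cases as with
        | nil =>
          have := IsForest.wrap a (ih F [] (by simp))
          simp only [List.nil_append] at h2
          subst h2
          simpa using this
        | cons d as =>
          simp at h2
          obtain ⟨rfl, rfl, rfl⟩ := h2
          have := IsForest.append (IsForest.wrap a hF) hP
          simpa using this
      · subst h2
        have := IsForest.wrap a (ih A bs h1)
        simpa using this

/-- Stack machine recognizing balanced strings. -/
noncomputable def stackRun {α : Type*} : List α → List (Paren α) → Option (List α)
  | s, [] => some s
  | s, (true, a) :: X => stackRun (a :: s) X
  | [], (false, _) :: _ => none
  | b :: s, (false, a) :: X => if a = b then stackRun s X else none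

theorem stackRun_forest {α : Type*} {P : List (Paren α)} (hP : IsForest P) :
    ∀ s X, stackRun s (P ++ X) = stackRun s X := by
  induction hP with
  | nil => intro s X; rfl
  | append _ _ ih1 ih2 => intro s X; rw [List.append_assoc, ih1, ih2]
  | wrap a _ ih =>
    intro s X
    simp only [List.cons_append, List.append_assoc, stackRun, ih]
    simp [stackRun]

theorem stackRun_append {α : Type*} (A Z : List (Paren α)) :
    ∀ s, stackRun s (A ++ Z) = (stackRun s A).bind (fun t => stackRun t Z) := by
  induction A with
  | nil => intro s; simp [stackRun]
  | cons c A ih =>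
    intro s
    obtain ⟨b, a⟩ := c
    cases b with
    | true => simp [stackRun, ih]
    | false =>
      cases s with
      | nil => simp [stackRun]
      | cons d s =>
        simp only [List.cons_append, stackRun]
        split_ifs <;> simp [ih]

theorem forest_of_stackRun {α : Type*} (X : List (Paren α)) :
    ∀ s : List α, stackRun s X = some [] →
      IsForest (s.reverse.map (fun a => (true, a)) ++ X) := by
  induction X with
  | nil =>
    intro s h
    simp only [stackRun, Option.some.injEq] at h
    subst h
    simpa using IsForest.nil
  | cons c X ih =>
    intro s h
    obtain ⟨b, a⟩ := c
    cases b with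
    | true =>
      have := ih (a :: s) h
      simpa using this
    | false =>
      cases s with
      | nil => simp [stackRun] at h
      | cons d s =>
        simp only [stackRun] at h
        split_ifs at h with hd
        subst hd
        have h1 := ih s h
        have h2 : IsForest [((true, a) : Paren α), (false, a)] := IsForest.wrap a IsForest.nil
        have := forest_insert h2 h1 _ _ rfl
        simpa using this

theorem forest_iff_run {α : Type*} (X : List (Paren α)) :
    IsForest X ↔ stackRun [] X = some [] := by
  constructor
  · intro h
    have := stackRun_forest h [] []
    simpa [stackRun] using this
  · intro h
    simpa using forest_of_stackRun X [] h

theorem forest_remove {α : Type*} {P : List (Paren α)} (hP : IsForest P) (A B : List (Paren α)) :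
    IsForest (A ++ P ++ B) ↔ IsForest (A ++ B) := by
  rw [forest_iff_run, forest_iff_run, List.append_assoc, stackRun_append, stackRun_append]
  simp only [stackRun_forest hP]

/-- Height of a string. -/
noncomputable def ht {α : Type*} (X : List (Paren α)) : ℤ := (X.map (fun c => if c.1 = true then (1 : ℤ) else -1)).sum

theorem ht_append {α : Type*} (X Y : List (Paren α)) : ht (X ++ Y) = ht X + ht Y := by
  simp [ht]

theorem ht_forest {α : Type*} {P : List (Paren α)} (hP : IsForest P) : ht P = 0 := by
  induction hP with
  | nil => rfl
  | append _ _ ih1 ih2 => rw [ht_append, ih1, ih2]; rfl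
  | wrap a _ ih =>
    have : ∀ X Y : List (Paren α), ∀ a, ht ((true, a) :: X ++ Y) = 1 + ht X + ht Y := by
      intro X Y a; simp [ht]; ring
    rw [this, ih]
    simp [ht]

theorem ht_prefix {α : Type*} {P : List (Paren α)} (hP : IsForest P) :
    ∀ n, 0 ≤ ht (P.take n) := by
  induction hP with
  | nil => intro n; simp [ht]
  | @append F G hF _ ih1 ih2 =>
    intro n
    rw [List.take_append, ht_append]
    exact add_nonneg (ih1 _) (ih2 _)
  | @wrap F a hF ih =>
    intro n
    cases n with
    | zero => simp [ht]
    | succ n =>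
      rw [List.cons_append, List.take_succ_cons, List.take_append]
      have : ∀ X Y : List (Paren α), ∀ a, ht ((true, a) :: (X ++ Y)) = 1 + ht X + ht Y := by
        intro X Y a; simp [ht]; ring
      rw [this]
      have h1 := ih n
      have h2 : -1 ≤ ht (List.take (n - F.length) [((false, a) : Paren α)]) := by
        cases n - F.length <;> simp [ht]
      linarith

theorem H_succ {α : Type*} (X : List (Paren α)) (i : ℕ) (b : Bool) (a : α)
    (h : X[i]? = some (b, a)) :
    ht (X.take (i + 1)) = ht (X.take i) + (if b = true then (1 : ℤ) else -1) := by
  rw [List.take_add_one, ht_append, h]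
  simp [ht]

theorem frag_getElem? {β : Type*} (l : List β) (i j q : ℕ) :
    (frag l i j)[q]? = if i + q < j then l[i + q]? else none := by
  simp [frag, List.getElem?_drop, List.getElem?_take]

theorem node_height {α : Type*} {X : List (Paren α)} {i j : ℕ} (h : IsNode X i j) :
    ht (X.take (j + 1)) = ht (X.take i) ∧
      ∀ q, i < q → q ≤ j → ht (X.take i) < ht (X.take q) := by
  obtain ⟨hij, hj, ⟨a, h1, h2⟩, hf⟩ := h
  have key : ∀ q, i < q → q ≤ j →
      ht (X.take q) = ht (X.take i) + 1 + ht ((frag X (i + 1) j).take (q - (i + 1))) := by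
    intro q hq1 hq2
    have e1 := H_succ X i true a h1
    simp only [if_true] at e1
    rw [← e1, ← ht_append]
    congr 1
    have : (frag X (i + 1) j).take (q - (i + 1)) = (X.take q).drop (i + 1) := by
      rw [frag, List.take_drop, List.take_take]
      congr 2
      omega
    rw [this]
    conv_lhs => rw [← List.take_append_drop (i + 1) (X.take q)]
    rw [List.take_take, min_eq_left (by omega)]
  constructor
  · have e2 := H_succ X j false a h2
    rw [e2, key j hij le_rfl]
    rw [List.take_of_length_le (l := frag X (i + 1) j) (by simp [frag]; omega), ht_forest hf]
    simp
  · intro q hq1 hq2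
    rw [key q hq1 hq2]
    have := ht_prefix hf (q - (i + 1))
    linarith

theorem node_open {α : Type*} {X : List (Paren α)} {i j : ℕ} (h : IsNode X i j) :
    ∃ a, X[i]? = some (true, a) ∧ X[j]? = some (false, a) := h.2.2.1

theorem mate_unique {α : Type*} {X : List (Paren α)} {i j j' : ℕ} (h : MateRel X i j)
    (h' : MateRel X i j') : j = j' := by
  rcases h with h | h <;> rcases h' with h' | h'
  · obtain ⟨e1, l1⟩ := node_height h
    obtain ⟨e2, l2⟩ := node_height h'
    rcases lt_trichotomy j j' with hl | hl | hl
    · have := l2 (j + 1) (by have := h.1; omega) hl; omega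
    · exact hl
    · have := l1 (j' + 1) (by have := h'.1; omega) hl; omega
  · obtain ⟨a, h1, h2⟩ := node_open h
    obtain ⟨b, h3, h4⟩ := node_open h'
    rw [h1] at h4; simp at h4
  · obtain ⟨a, h1, h2⟩ := node_open h
    obtain ⟨b, h3, h4⟩ := node_open h'
    rw [h2] at h3; simp at h3
  · obtain ⟨e1, l1⟩ := node_height h
    obtain ⟨e2, l2⟩ := node_height h'
    rcases lt_trichotomy j j' with hl | hl | hl
    · have := l1 j' hl h'.1.le; omega
    · exact hl
    · have := l2 j hl h.1.le; omega

theorem mate_symm {α : Type*} {X : List (Paren α)} {i j : ℕ} (h : MateRel X i j) :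
    MateRel X j i := Or.symm h

theorem mate_ne {α : Type*} {X : List (Paren α)} {i j : ℕ} (h : MateRel X i j) : i ≠ j := by
  rcases h with h | h <;> have := h.1 <;> omega

theorem mate_lt {α : Type*} {X : List (Paren α)} {i j : ℕ} (h : MateRel X i j) :
    i < X.length ∧ j < X.length := by
  rcases h with h | h <;> have := h.1 <;> have := h.2.1 <;> omega

theorem mate_lbl {α : Type*} {X : List (Paren α)} {i j : ℕ} (h : MateRel X i j) :
    lbl X i = lbl X j := by
  rcases h with h | h <;> obtain ⟨a, h1, h2⟩ := node_open h <;> simp [lbl, h1, h2]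

theorem frag_mid {β : Type*} (A X B : List β) (i j : ℕ) (hj : j ≤ X.length) :
    frag (A ++ X ++ B) (A.length + i) (A.length + j) = frag X i j := by
  apply List.ext_getElem?
  intro q
  rw [frag_getElem?, frag_getElem?]
  by_cases h : i + q < j
  · rw [if_pos (by omega), if_pos h, List.append_assoc, List.getElem?_append_right (by omega),
      List.getElem?_append_left (by omega)]
    congr 1
    omega
  · rw [if_neg (by omega), if_neg h]

theorem getElem?_mid {β : Type*} (A X B : List β) (i : ℕ) (hi : i < X.length) :
    (A ++ X ++ B)[A.length + i]? = X[i]? := by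
  rw [List.append_assoc, List.getElem?_append_right (by omega),
      List.getElem?_append_left (by omega)]
  congr 1
  omega

theorem node_mid {α : Type*} (A X B : List (Paren α)) (i j : ℕ) (hj : j < X.length) :
    IsNode (A ++ X ++ B) (A.length + i) (A.length + j) ↔ IsNode X i j := by
  unfold IsNode
  rw [add_assoc A.length i 1, frag_mid _ _ _ _ _ hj.le]
  constructor
  · rintro ⟨h1, h2, h3, h4⟩
    refine ⟨by omega, hj, ?_, h4⟩
    rwa [getElem?_mid _ _ _ _ (by omega), getElem?_mid _ _ _ _ hj] at h3
  · rintro ⟨h1, h2, h3, h4⟩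
    refine ⟨by omega, by simp; omega, ?_, h4⟩
    rwa [getElem?_mid _ _ _ _ (by omega), getElem?_mid _ _ _ _ hj]

theorem mate_mid {α : Type*} (A X B : List (Paren α)) (i j : ℕ) (hi : i < X.length)
    (hj : j < X.length) :
    MateRel (A ++ X ++ B) (A.length + i) (A.length + j) ↔ MateRel X i j := by
  unfold MateRel
  rw [node_mid _ _ _ _ _ hi, node_mid _ _ _ _ _ hj]

theorem mate_exists {α : Type*} {X : List (Paren α)} (hX : IsForest X) :
    ∀ i, i < X.length → ∃ j, MateRel X i j := by
  induction hX with
  | nil => intro i hi; simp at hi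
  | @append F G hF hG ih1 ih2 =>
    intro i hi
    by_cases h : i < F.length
    · obtain ⟨j, hj⟩ := ih1 i h
      refine ⟨j, ?_⟩
      have := (mate_mid [] F G i j h (mate_lt hj).2).2 hj
      simpa using this
    · simp at hi
      obtain ⟨j, hj⟩ := ih2 (i - F.length) (by omega)
      refine ⟨F.length + j, ?_⟩
      have := (mate_mid F G [] (i - F.length) j (by omega) (mate_lt hj).2).2 hj
      rw [Nat.add_sub_cancel' (by omega)] at this
      simpa using this
  | @wrap F a hF ih =>
    have hroot : IsNode ((true, a) :: F ++ [(false, a)]) 0 (F.length + 1) := by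
      refine ⟨by omega, by simp, ⟨a, by simp, by simp⟩, ?_⟩
      have := frag_mid [((true, a) : Paren α)] F [(false, a)] 0 F.length le_rfl
      simp only [List.length_singleton, add_zero] at this
      rw [zero_add, add_comm]
      rw [show (true, a) :: F ++ [(false, a)] = [((true, a) : Paren α)] ++ F ++ [(false, a)] by simp,
        this]
      simpa [frag] using hF
    intro i hi
    simp at hi
    rcases Nat.eq_zero_or_pos i with h0 | h0
    · subst h0; exact ⟨_, Or.inl hroot⟩
    rcases Nat.lt_or_ge i (F.length + 1) with h1 | h1
    · obtain ⟨j, hj⟩ := ih (i - 1) (by omega)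
      refine ⟨1 + j, ?_⟩
      have := (mate_mid [((true, a) : Paren α)] F [(false, a)] (i - 1) j (by omega) (mate_lt hj).2).2 hj
      simp only [List.length_singleton] at this
      rw [Nat.add_sub_cancel' (by omega)] at this
      simpa using this
    · have : i = F.length + 1 := by omega
      subst this; exact ⟨_, Or.inr hroot⟩

/-- Embedding of positions of `F1 ++ F2` into positions of `F1 ++ P ++ F2`. -/
def emb (l n i : ℕ) : ℕ := if i < l then i else i + n

theorem getElem?_emb {β : Type*} (A X B : List β) (i : ℕ) :
    (A ++ X ++ B)[emb A.length X.length i]? = (A ++ B)[i]? := by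
  unfold emb
  split_ifs with h
  · rw [List.append_assoc, List.getElem?_append_left h, List.getElem?_append_left h]
  · rw [List.getElem?_append_right (by simp; omega), List.getElem?_append_right (by omega)]
    congr 1
    simp; omega

theorem node_emb {α : Type*} {P : List (Paren α)} (hP : IsForest P) (A B : List (Paren α))
    (i j : ℕ) :
    IsNode (A ++ P ++ B) (emb A.length P.length i) (emb A.length P.length j) ↔
      IsNode (A ++ B) i j := by
  unfold IsNode
  rw [getElem?_emb, getElem?_emb]
  have e1 : emb A.length P.length i < emb A.length P.length j ↔ i < j := by
    unfold emb; split_ifs <;> omega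
  have e2 : emb A.length P.length j < (A ++ P ++ B).length ↔ j < (A ++ B).length := by
    unfold emb; simp; split_ifs <;> omega
  rw [e1, e2]
  refine and_congr_right fun hij => and_congr_right fun hj => and_congr_right fun _ => ?_
  simp only [List.length_append] at hj
  unfold emb
  by_cases h1 : j < A.length
  · rw [if_pos h1, if_pos (by omega)]
    have a1 := frag_mid [] A (P ++ B) (i + 1) j h1.le
    have a2 := frag_mid [] A B (i + 1) j h1.le
    simp only [List.length_nil, zero_add, List.nil_append, ← List.append_assoc] at a1 a2
    rw [a1, a2]
  · rw [if_neg h1]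
    by_cases h2 : i < A.length
    · rw [if_pos h2]
      have a1 : frag (A ++ P ++ B) (i + 1) (j + P.length)
          = A.drop (i + 1) ++ P ++ B.take (j - A.length) := by
        unfold frag
        rw [List.take_append, List.take_of_length_le (by simp; omega), List.append_assoc,
          List.drop_append_of_le_length (by omega), List.append_assoc]
        congr 3
        simp; omega
      have a2 : frag (A ++ B) (i + 1) j = A.drop (i + 1) ++ B.take (j - A.length) := by
        unfold frag
        rw [List.take_append, List.take_of_length_le (by omega),
          List.drop_append_of_le_length (by omega)]
      rw [a1, a2, forest_remove hP]
    · rw [if_neg h2]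
      have a1 := frag_mid (A ++ P) B [] (i - A.length + 1) (j - A.length) (by omega)
      have a2 := frag_mid A B [] (i - A.length + 1) (j - A.length) (by omega)
      simp only [List.append_nil, List.length_append] at a1 a2
      rw [show A.length + P.length + (i - A.length + 1) = i + P.length + 1 by omega,
        show A.length + P.length + (j - A.length) = j + P.length by omega] at a1
      rw [show A.length + (i - A.length + 1) = i + 1 by omega,
        show A.length + (j - A.length) = j by omega] at a2
      rw [a1, a2]

theorem mate_emb {α : Type*} {P : List (Paren α)} (hP : IsForest P) (A B : List (Paren α))
    (i j : ℕ) :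
    MateRel (A ++ P ++ B) (emb A.length P.length i) (emb A.length P.length j) ↔
      MateRel (A ++ B) i j := by
  unfold MateRel
  rw [node_emb hP, node_emb hP]

/-- `N` is a list of node identifiers for the positions of `X`. -/
def Valid {α E : Type*} (X : List (Paren α)) (N : List E) : Prop :=
  N.length = X.length ∧ ∀ i j, i < X.length → j < X.length →
    (N[i]? = N[j]? ↔ i = j ∨ MateRel X i j)

theorem emb_cases (l n m i : ℕ) (hi : i < l + n + m) :
    (∃ q, q < n ∧ i = l + q) ∨ ∃ q, q < l + m ∧ i = emb l n q := by
  unfold emb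
  rcases Nat.lt_or_ge i l with h | h
  · exact Or.inr ⟨i, by omega, by rw [if_pos h]⟩
  rcases Nat.lt_or_ge i (l + n) with h' | h'
  · exact Or.inl ⟨i - l, by omega, by omega⟩
  · exact Or.inr ⟨i - n, by omega, by rw [if_neg (by omega)]; omega⟩

theorem valid_ins {α E : Type*} {P A B : List (Paren α)} {N1 NP N2 : List E} (hP : IsForest P)
    (hv : Valid (A ++ B) (N1 ++ N2)) (hl : N1.length = A.length) (hvP : Valid P NP)
    (hd : ∀ e ∈ NP, e ∉ N1 ++ N2) : Valid (A ++ P ++ B) (N1 ++ NP ++ N2) := by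
  have hlp := hvP.1
  have hlv := hv.1
  simp only [List.length_append] at hlv
  refine ⟨by simp; omega, ?_⟩
  have mixed : ∀ q q', q < P.length → q' < A.length + B.length →
      (N1 ++ NP ++ N2)[A.length + q]? ≠ (N1 ++ NP ++ N2)[emb A.length P.length q']? ∧
      A.length + q ≠ emb A.length P.length q' ∧
      ¬ MateRel (A ++ P ++ B) (A.length + q) (emb A.length P.length q') := by
    intro q q' hq hq'
    have hne : ∀ q, q < P.length → A.length + q ≠ emb A.length P.length q' := by
      intro q hq
      unfold emb; split_ifs <;> omega
    refine ⟨?_, hne q hq, ?_⟩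
    · rw [← hl, ← hlp, getElem?_emb, getElem?_mid _ _ _ _ (by omega)]
      intro h
      have h1 : NP[q]? = some (NP[q]'(by omega)) := List.getElem?_eq_getElem _
      rw [h1] at h
      exact hd _ (List.getElem_mem _) (List.mem_of_getElem? h.symm)
    · intro h
      obtain ⟨j, hj⟩ := mate_exists hP q hq
      have h2 := (mate_mid A P B q j hq (mate_lt hj).2).2 hj
      exact hne j (mate_lt hj).2 (mate_unique h2 h)
  intro i j hi hj
  simp only [List.length_append] at hi hj
  rcases emb_cases _ _ _ i hi with ⟨q, hq, rfl⟩ | ⟨q, hq, rfl⟩ <;>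
    rcases emb_cases _ _ _ j hj with ⟨q', hq', rfl⟩ | ⟨q', hq', rfl⟩
  · rw [mate_mid _ _ _ _ _ hq hq']
    have := hvP.2 q q' hq hq'
    rw [← hl, getElem?_mid _ _ _ _ (by omega), getElem?_mid _ _ _ _ (by omega), this]
    simp
  · obtain ⟨m1, m2, m3⟩ := mixed q q' hq hq'
    simp only [m1, m2, m3, or_self]
  · obtain ⟨m1, m2, m3⟩ := mixed q' q hq' hq
    have m3' := fun h => m3 (mate_symm h)
    simp only [m1.symm, m2.symm, iff_false_intro m3', or_self]
  · rw [mate_emb hP, ← hl, ← hlp, getElem?_emb, getElem?_emb,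
      hv.2 q q' (by simpa using hq) (by simpa using hq')]
    have : emb N1.length NP.length q = emb N1.length NP.length q' ↔ q = q' := by
      unfold emb; split_ifs <;> omega
    rw [this]

/-- Identifiers: a tag, a number, and a label. -/
abbrev NId (α : Type*) := Bool × ℕ × Option α

open Classical in
/-- The mate of a position (junk if it does not exist). -/
noncomputable def mateOf {α : Type*} (X : List (Paren α)) (i : ℕ) : ℕ :=
  if h : ∃ j, MateRel X i j then h.choose else i

noncomputable def annot {α : Type*} (tag : Bool) (X : List (Paren α)) : List (NId α) :=
  (List.range X.length).map (fun i => (tag, min i (mateOf X i), lbl X i))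

theorem annot_getElem? {α : Type*} (tag : Bool) (X : List (Paren α)) (i : ℕ) (hi : i < X.length) :
    (annot tag X)[i]? = some (tag, min i (mateOf X i), lbl X i) := by
  simp [annot, hi]

theorem annot_valid {α : Type*} (tag : Bool) {X : List (Paren α)} (hX : IsForest X) :
    Valid X (annot tag X) := by
  refine ⟨by simp [annot], ?_⟩
  have hm : ∀ i, i < X.length → MateRel X i (mateOf X i) := by
    intro i hi
    have := mate_exists hX i hi
    unfold mateOf
    rw [dif_pos this]
    exact this.choose_spec
  intro i j hi hj
  rw [annot_getElem? _ _ _ hi, annot_getElem? _ _ _ hj]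
  simp only [Option.some.injEq, Prod.mk.injEq, true_and]
  have mi := hm i hi
  have mj := hm j hj
  constructor
  · rintro ⟨h, -⟩
    rcases min_choice i (mateOf X i) with h1 | h1 <;>
      rcases min_choice j (mateOf X j) with h2 | h2 <;> rw [h1, h2] at h
    · exact Or.inl h
    · right; rw [h]; exact mate_symm mj
    · right; rw [← h]; exact mi
    · left
      rw [h] at mi
      exact mate_unique (mate_symm mi) (mate_symm mj)
  · rintro (rfl | h)
    · simp
    · have e1 := mate_unique mi h
      have e2 := mate_unique mj (mate_symm h)
      rw [e1, e2]
      exact ⟨min_comm _ _, mate_lbl h⟩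

theorem annot_tag {α : Type*} (tag : Bool) (X : List (Paren α)) :
    ∀ e ∈ annot tag X, e.1 = tag := by
  intro e he
  simp only [annot, List.mem_map] at he
  obtain ⟨i, _, rfl⟩ := he
  rfl

/-! ### Part 2: column representation of alignments and elimination of common nodes -/

/-- Consistency of a list of columns of node identifiers. -/
def IdCons {E : Type*} (L : List (Option E × Option E)) : Prop :=
  ∀ s t, (some s, some t) ∈ L → ∀ c ∈ L, (c.1 = some s ↔ c.2 = some t)

/-- Cost of a list of columns. -/
noncomputable def colCost {E F α : Type*} (w : Option α → Option α → ℝ≥0) (lf : E → Option α)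
    (lg : F → Option α) (L : List (Option E × Option F)) : ℝ≥0 :=
  (L.map (fun c => (1 / 2 : ℝ≥0) * w (c.1.bind lf) (c.2.bind lg))).sum

/-- Erasing an identifier from an optional entry. -/
noncomputable def er1 {E : Type*} (u : E) (o : Option E) : Option E :=
  if o = some u then none else o

/-- Erasing an identifier from a column. -/
noncomputable def er {E : Type*} (u : E) (c : Option E × Option E) : Option E × Option E :=
  (er1 u c.1, er1 u c.2)

theorem er1_eq_some {E : Type*} (u s : E) (o : Option E) :
    er1 u o = some s ↔ o = some s ∧ s ≠ u := by
  unfold er1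
  split_ifs with h
  · subst h; simp; tauto
  · constructor
    · rintro rfl; exact ⟨rfl, fun h' => h (by rw [h'])⟩
    · exact fun h' => h'.1

theorem idCons_er {E : Type*} (u : E) {L : List (Option E × Option E)} (h : IdCons L) :
    IdCons (L.map (er u)) := by
  intro s t hst c hc
  obtain ⟨c0, hc0, e0⟩ := List.mem_map.1 hst
  obtain ⟨c1, hc1, rfl⟩ := List.mem_map.1 hc
  simp only [er, Prod.mk.injEq, er1_eq_some] at e0 ⊢
  obtain ⟨⟨a1, a2⟩, a3, a4⟩ := e0
  have := h s t (by rw [← a1, ← a3]; exact hc0) c1 hc1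
  simp [a2, a4, this]

theorem filterMap_er_fst {E : Type*} (u : E) (L : List (Option E × Option E)) :
    (L.map (er u)).filterMap Prod.fst = (L.filterMap Prod.fst).filter (fun e => e ≠ u) := by
  induction L with
  | nil => rfl
  | cons c L ih =>
    obtain ⟨a, b⟩ := c
    rw [List.map_cons, List.filterMap_cons, ih, List.filterMap_cons]
    cases a with
    | none => simp [er, er1]
    | some a => by_cases h : a = u <;> simp [er, er1, h]

theorem filterMap_er_snd {E : Type*} (u : E) (L : List (Option E × Option E)) :
    (L.map (er u)).filterMap Prod.snd = (L.filterMap Prod.snd).filter (fun e => e ≠ u) := by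
  induction L with
  | nil => rfl
  | cons c L ih =>
    obtain ⟨a, b⟩ := c
    rw [List.map_cons, List.filterMap_cons, ih, List.filterMap_cons]
    cases b with
    | none => simp [er, er1]
    | some a => by_cases h : a = u <;> simp [er, er1, h]

/-- Indicator sum over first components. -/
theorem ind_fst {E : Type*} (u : E) (W : ℝ≥0) (L : List (Option E × Option E)) :
    (L.map (fun c => if c.1 = some u then W else 0)).sum
      = ((L.filterMap Prod.fst).map (fun e => if e = u then W else 0)).sum := by
  induction L with
  | nil => rfl
  | cons c L ih =>
    obtain ⟨a, b⟩ := c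
    cases a <;> simp [ih]

theorem ind_snd {E : Type*} (u : E) (W : ℝ≥0) (L : List (Option E × Option E)) :
    (L.map (fun c => if c.2 = some u then W else 0)).sum
      = ((L.filterMap Prod.snd).map (fun e => if e = u then W else 0)).sum := by
  induction L with
  | nil => rfl
  | cons c L ih =>
    obtain ⟨a, b⟩ := c
    cases b <;> simp [ih]

theorem ind_zero {E : Type*} (u : E) (W : ℝ≥0) (X : List E) (h : u ∉ X) :
    (X.map (fun e => if e = u then W else 0)).sum = 0 := by
  apply List.sum_eq_zero
  intro x hx
  obtain ⟨e, he, rfl⟩ := List.mem_map.1 hx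
  rw [if_neg]
  rintro rfl
  exact h he

theorem last_col {E : Type*} (u : E) (L : List (Option E × Option E)) : ∀ X Y : List E,
    L.filterMap Prod.fst = X ++ [u] → L.filterMap Prod.snd = Y ++ [u] →
    (some u, some u) ∈ L ∨ (some u, none) ∈ L ∨ (none, some u) ∈ L := by
  induction L using List.reverseRecOn with
  | nil => intro X Y h; simp at h
  | append_singleton L c ih =>
    intro X Y h1 h2
    obtain ⟨a, b⟩ := c
    rw [List.filterMap_append] at h1 h2
    cases a <;> cases b
    · simp at h1 h2
      rcases ih X Y h1 h2 with h | h | h <;> simp [h]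
    · simp at h2
      obtain ⟨_, rfl⟩ := h2
      simp
    · simp at h1
      obtain ⟨_, rfl⟩ := h1
      simp
    · simp at h1 h2
      obtain ⟨_, rfl⟩ := h1
      obtain ⟨_, rfl⟩ := h2
      simp

theorem first_col {E : Type*} (u : E) (L : List (Option E × Option E)) : ∀ X Y : List E,
    L.filterMap Prod.fst = u :: X → L.filterMap Prod.snd = u :: Y →
    (some u, some u) ∈ L ∨ (some u, none) ∈ L ∨ (none, some u) ∈ L := by
  induction L with
  | nil => intro X Y h; simp at h
  | cons c L ih =>
    intro X Y h1 h2
    obtain ⟨a, b⟩ := c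
    cases a <;> cases b
    · simp at h1 h2
      rcases ih X Y h1 h2 with h | h | h <;> simp [h]
    · simp at h2
      obtain ⟨rfl, _⟩ := h2
      simp
    · simp at h1
      obtain ⟨rfl, _⟩ := h1
      simp
    · simp at h1 h2
      obtain ⟨rfl, _⟩ := h1
      obtain ⟨rfl, _⟩ := h2
      simp

theorem er1_bind {E α : Type*} (u : E) (o : Option E) (lf : E → Option α) :
    (er1 u o).bind lf = if o = some u then none else o.bind lf := by
  unfold er1; split_ifs <;> rfl

theorem er_cost {E α : Type*} (w : Option α → Option α → ℝ≥0) (hn : Normalized w)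
    (hq : Quasimetric w) (lf : E → Option α) (u : E) (L : List (Option E × Option E))
    (hc : IdCons L)
    (hcount : ∀ W : ℝ≥0, ((L.filterMap Prod.fst).map (fun e => if e = u then W else 0)).sum
      = ((L.filterMap Prod.snd).map (fun e => if e = u then W else 0)).sum)
    (hu : (some u, some u) ∈ L ∨ (some u, none) ∈ L ∨ (none, some u) ∈ L) :
    colCost w lf lf (L.map (er u)) ≤ colCost w lf lf L := by
  unfold colCost
  rw [List.map_map]
  rcases hu with hu | hu | hu
  · apply List.sum_le_sum
    intro c hcL
    have := hc u u hu c hcL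
    simp only [Function.comp, er, er1_bind]
    by_cases h : c.1 = some u
    · have h2 := this.1 h
      simp [h, h2, hn.1]
    · have h2 : ¬ c.2 = some u := fun h' => h (this.2 h')
      simp [h, h2]
  · have hno : ∀ c ∈ L, c.1 = some u → c.2 = none := by
      rintro ⟨a, b⟩ hcL rfl
      cases b with
      | none => rfl
      | some t => exact absurd ((hc u t hcL _ hu).1 rfl) (by simp)
    set W : ℝ≥0 := (1 / 2) * w (lf u) none with hW
    have key : ∀ c ∈ L, ((1 / 2 : ℝ≥0) * w ((er u c).1.bind lf) ((er u c).2.bind lf))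
        + (if c.1 = some u then W else 0)
        ≤ ((1 / 2 : ℝ≥0) * w (c.1.bind lf) (c.2.bind lf)) + (if c.2 = some u then W else 0) := by
      intro c hcL
      simp only [er, er1_bind]
      by_cases h : c.1 = some u
      · have h2 := hno c hcL h
        simp [h, h2, hn.1, hW]
      · by_cases h2 : c.2 = some u
        · simp only [h, h2, if_true, if_false, add_zero, hW, Option.bind_some]
          rw [← mul_add]
          gcongr
          exact hq _ _ _
        · simp [h, h2]
    have := List.sum_le_sum key
    rw [List.sum_map_add, List.sum_map_add, ind_fst, ind_snd, hcount] at this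
    exact le_of_add_le_add_right this
  · have hno : ∀ c ∈ L, c.2 = some u → c.1 = none := by
      rintro ⟨a, b⟩ hcL rfl
      cases a with
      | none => rfl
      | some t => exact absurd ((hc t u hcL _ hu).2 rfl) (by simp)
    set W : ℝ≥0 := (1 / 2) * w none (lf u) with hW
    have key : ∀ c ∈ L, ((1 / 2 : ℝ≥0) * w ((er u c).1.bind lf) ((er u c).2.bind lf))
        + (if c.2 = some u then W else 0)
        ≤ ((1 / 2 : ℝ≥0) * w (c.1.bind lf) (c.2.bind lf)) + (if c.1 = some u then W else 0) := by
      intro c hcL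
      simp only [er, er1_bind]
      by_cases h : c.2 = some u
      · have h2 := hno c hcL h
        simp [h, h2, hn.1, hW]
      · by_cases h2 : c.1 = some u
        · simp only [h, h2, if_true, if_false, add_zero, hW, Option.bind_some]
          rw [← mul_add, add_comm]
          gcongr
          exact hq _ _ _
        · simp [h, h2]
    have := List.sum_le_sum key
    rw [List.sum_map_add, List.sum_map_add, ind_fst, ind_snd, hcount] at this
    exact le_of_add_le_add_right this

theorem elim_common {E α : Type*} (w : Option α → Option α → ℝ≥0) (hn : Normalized w)
    (hq : Quasimetric w) (lf : E → Option α) (F1 F2 G1 G2 : List E) (n : ℕ) :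
    ∀ (P0 P1 : List E) (L0 L1 : List (Option E × Option E)), P0.length + P1.length ≤ n →
    L0.filterMap Prod.fst = F1 ++ P0 → L0.filterMap Prod.snd = G1 ++ P0 →
    L1.filterMap Prod.fst = P1 ++ F2 → L1.filterMap Prod.snd = P1 ++ G2 →
    (∀ e ∈ P0 ++ P1, e ∉ F1 ∧ e ∉ F2 ∧ e ∉ G1 ∧ e ∉ G2) → IdCons (L0 ++ L1) →
    ∃ L0' L1', L0'.filterMap Prod.fst = F1 ∧ L0'.filterMap Prod.snd = G1 ∧
      L1'.filterMap Prod.fst = F2 ∧ L1'.filterMap Prod.snd = G2 ∧ IdCons (L0' ++ L1') ∧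
      colCost w lf lf (L0' ++ L1') ≤ colCost w lf lf (L0 ++ L1) := by
  induction n with
  | zero =>
    intro P0 P1 L0 L1 hlen h1 h2 h3 h4 hd hc
    have e0 : P0 = [] := List.length_eq_zero_iff.1 (by omega)
    have e1 : P1 = [] := List.length_eq_zero_iff.1 (by omega)
    subst e0 e1
    exact ⟨L0, L1, by simpa using h1, by simpa using h2, by simpa using h3, by simpa using h4, hc,
      le_rfl⟩
  | succ n ih =>
    intro P0 P1 L0 L1 hlen h1 h2 h3 h4 hd hc
    by_cases hemp : P0 ++ P1 = []
    · obtain ⟨e0, e1⟩ := List.append_eq_nil_iff.1 hemp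
      subst e0 e1
      exact ⟨L0, L1, by simpa using h1, by simpa using h2, by simpa using h3, by simpa using h4, hc,
        le_rfl⟩
    have hex : ∃ u ∈ P0 ++ P1, (some u, some u) ∈ L0 ++ L1 ∨ (some u, none) ∈ L0 ++ L1 ∨
        (none, some u) ∈ L0 ++ L1 := by
      rcases List.eq_nil_or_concat P0 with e0 | ⟨P0', u, e0⟩
      · cases P1 with
        | nil => exact absurd (by rw [e0]; rfl) hemp
        | cons u P1 =>
          refine ⟨u, by simp, ?_⟩
          rcases first_col u L1 _ _ h3 h4 with h | h | h <;> simp [h]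
      · rw [e0, List.concat_eq_append, ← List.append_assoc] at h1 h2
        refine ⟨u, by simp [e0], ?_⟩
        rcases last_col u L0 _ _ h1 h2 with h | h | h <;> simp [h]
    obtain ⟨u, huP, hu⟩ := hex
    obtain ⟨d1, d2, d3, d4⟩ := hd u huP
    have hf : ∀ X : List E, u ∉ X → X.filter (fun e => e ≠ u) = X := by
      intro X hX
      rw [List.filter_eq_self]
      intro a ha
      simp
      rintro rfl
      exact hX ha
    have hcost := er_cost w hn hq lf u (L0 ++ L1) hc (by
      intro W
      rw [List.filterMap_append, List.filterMap_append, h1, h2, h3, h4]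
      simp only [List.map_append, List.sum_append]
      rw [ind_zero u W _ d1, ind_zero u W _ d2, ind_zero u W _ d3, ind_zero u W _ d4]) hu
    obtain ⟨L0', L1', r1, r2, r3, r4, r5, r6⟩ := ih (P0.filter (fun e => e ≠ u))
      (P1.filter (fun e => e ≠ u)) (L0.map (er u)) (L1.map (er u)) (by
        have : ((P0 ++ P1).filter (fun e => e ≠ u)).length < (P0 ++ P1).length := by
          rw [List.length_filter_lt_length_iff_exists]
          exact ⟨u, huP, by simp⟩
        rw [List.filter_append, List.length_append, List.length_append] at this
        omega)
      (by rw [filterMap_er_fst, h1, List.filter_append, hf _ d1])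
      (by rw [filterMap_er_snd, h2, List.filter_append, hf _ d3])
      (by rw [filterMap_er_fst, h3, List.filter_append, hf _ d2])
      (by rw [filterMap_er_snd, h4, List.filter_append, hf _ d4])
      (by
        intro e he
        rw [← List.filter_append] at he
        exact hd e (List.mem_of_mem_filter he))
      (by rw [← List.map_append]; exact idCons_er u hc)
    refine ⟨L0', L1', r1, r2, r3, r4, r5, r6.trans ?_⟩
    rw [← List.map_append]
    exact hcost

/-! ### Part 3: paths and columns -/

/-- The column of a step of a path. -/
noncomputable def stepCol (p q : ℕ × ℕ) : Option ℕ × Option ℕ :=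
  (if q.1 = p.1 + 1 then some p.1 else none, if q.2 = p.2 + 1 then some p.2 else none)

/-- The columns of a path. -/
noncomputable def cols : List (ℕ × ℕ) → List (Option ℕ × Option ℕ)
  | [] => []
  | [_] => []
  | p :: q :: rest => stepCol p q :: cols (q :: rest)

theorem alignsAt_cons {p q : ℕ × ℕ} {r : List (ℕ × ℕ)} {f g : ℕ} :
    AlignsAt (p :: q :: r) f g ↔ (p = (f, g) ∧ q = (f + 1, g + 1)) ∨ AlignsAt (q :: r) f g := by
  constructor
  · rintro ⟨t, h1, h2⟩
    cases t with
    | zero => left; simpa using And.intro h1 h2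
    | succ t => right; exact ⟨t, by simpa using h1, by simpa using h2⟩
  · rintro (⟨rfl, rfl⟩ | ⟨t, h1, h2⟩)
    · exact ⟨0, by simp, by simp⟩
    · exact ⟨t + 1, by simpa using h1, by simpa using h2⟩

theorem alignsAt_single {p : ℕ × ℕ} {f g : ℕ} : ¬ AlignsAt [p] f g := by
  rintro ⟨t, h1, h2⟩
  simp at h2

theorem isAlignment_cons {x x' y y' : ℕ} {p q : ℕ × ℕ} {r : List (ℕ × ℕ)} :
    IsAlignment x x' y y' (p :: q :: r) ↔
      p = (x, y) ∧ AlignStep p q ∧ IsAlignment q.1 x' q.2 y' (q :: r) := by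
  unfold IsAlignment
  have e : List.Chain' AlignStep = List.IsChain AlignStep := rfl
  rw [e, List.isChain_cons_cons]
  simp only [List.head?_cons, Option.some.injEq, List.getLast?_cons_cons, Prod.mk.eta, true_and]
  tauto

theorem isAlignment_single {x x' y y' : ℕ} {p : ℕ × ℕ} :
    IsAlignment x x' y y' [p] ↔ p = (x, y) ∧ p = (x', y') := by
  unfold IsAlignment
  have e : List.Chain' AlignStep = List.IsChain AlignStep := rfl
  rw [e]
  simp

theorem not_isAlignment_nil {x x' y y' : ℕ} : ¬ IsAlignment x x' y y' [] := by
  rintro ⟨h, _⟩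
  simp at h

theorem cols_proj {p : List (ℕ × ℕ)} : ∀ {x x' y y' : ℕ}, IsAlignment x x' y y' p →
    ∃ n m, x' = x + n ∧ y' = y + m ∧ (cols p).filterMap Prod.fst = List.range' x n ∧
      (cols p).filterMap Prod.snd = List.range' y m := by
  induction p with
  | nil => intro x x' y y' h; exact absurd h not_isAlignment_nil
  | cons p r ih =>
    intro x x' y y' h
    cases r with
    | nil =>
      obtain ⟨h1, h2⟩ := isAlignment_single.1 h
      rw [h1] at h2
      simp only [Prod.mk.injEq] at h2
      exact ⟨0, 0, by omega, by omega, rfl, rfl⟩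
    | cons q r =>
      obtain ⟨rfl, hs, hr⟩ := isAlignment_cons.1 h
      obtain ⟨n, m, h1, h2, h3, h4⟩ := ih hr
      rw [cols]
      rcases hs with rfl | rfl | rfl
      · refine ⟨n + 1, m, by simp at h1 ⊢; omega, h2, ?_, ?_⟩
        · simp [stepCol, h3, List.range'_succ]
        · simp [stepCol, h4]
      · refine ⟨n, m + 1, h1, by simp at h2 ⊢; omega, ?_, ?_⟩
        · simp [stepCol, h3]
        · simp [stepCol, h4, List.range'_succ]
      · refine ⟨n + 1, m + 1, by simp at h1 ⊢; omega, by simp at h2 ⊢; omega, ?_, ?_⟩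
        · simp [stepCol, h3, List.range'_succ]
        · simp [stepCol, h4, List.range'_succ]

theorem cols_aligns {p : List (ℕ × ℕ)} : ∀ {x x' y y' : ℕ}, IsAlignment x x' y y' p →
    ∀ f g, AlignsAt p f g ↔ (some f, some g) ∈ cols p := by
  induction p with
  | nil => intro x x' y y' h; exact absurd h not_isAlignment_nil
  | cons p r ih =>
    intro x x' y y' h f g
    cases r with
    | nil => simp [alignsAt_single, cols]
    | cons q r =>
      obtain ⟨rfl, hs, hr⟩ := isAlignment_cons.1 h
      rw [alignsAt_cons, cols, List.mem_cons, ih hr]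
      apply or_congr_left
      rcases hs with rfl | rfl | rfl
      · simp [stepCol]; omega
      · simp [stepCol]; omega
      · simp [stepCol]; omega

theorem cols_cost {α : Type*} (w : Option α → Option α → ℝ≥0) (F G : List (Paren α))
    {p : List (ℕ × ℕ)} : ∀ {x x' y y' : ℕ}, IsAlignment x x' y y' p →
    pathCost w F G p = colCost w (lbl F) (lbl G) (cols p) := by
  induction p with
  | nil => intro x x' y y' h; exact absurd h not_isAlignment_nil
  | cons p r ih =>
    intro x x' y y' h
    cases r with
    | nil => rfl
    | cons q r =>
      obtain ⟨rfl, hs, hr⟩ := isAlignment_cons.1 h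
      rw [pathCost, cols, ih hr]
      unfold colCost
      rw [List.map_cons, List.sum_cons]
      congr 1
      rcases hs with rfl | rfl | rfl <;> simp [stepCol]

theorem path_of_cols {α : Type*} (w : Option α → Option α → ℝ≥0) (hn : Normalized w)
    (F G : List (Paren α)) (D : List (Option ℕ × Option ℕ)) : ∀ x y n m,
    D.filterMap Prod.fst = List.range' x n → D.filterMap Prod.snd = List.range' y m →
    ∃ r, IsAlignment x (x + n) y (y + m) ((x, y) :: r) ∧
      (∀ f g, AlignsAt ((x, y) :: r) f g ↔ (some f, some g) ∈ D) ∧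
      pathCost w F G ((x, y) :: r) = colCost w (lbl F) (lbl G) D := by
  induction D with
  | nil =>
    intro x y n m h1 h2
    have hn0 : n = 0 := by cases n <;> simp [List.range'_succ] at h1 ⊢
    have hm0 : m = 0 := by cases m <;> simp [List.range'_succ] at h2 ⊢
    subst hn0 hm0
    refine ⟨[], isAlignment_single.2 ⟨rfl, rfl⟩, ?_, rfl⟩
    intro f g
    simp [alignsAt_single]
  | cons c D ih =>
    intro x y n m h1 h2
    obtain ⟨a, b⟩ := c
    cases a <;> cases b
    · simp only [List.filterMap_cons] at h1 h2
      obtain ⟨r, r1, r2, r3⟩ := ih x y n m h1 h2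
      refine ⟨r, r1, ?_, ?_⟩
      · intro f g; rw [r2]; simp
      · rw [r3]; simp [colCost, hn.1]
    · simp only [List.filterMap_cons] at h1 h2
      cases m with
      | zero => simp at h2
      | succ m =>
        rw [List.range'_succ] at h2
        simp only [List.cons.injEq] at h2
        obtain ⟨rfl, h2⟩ := h2
        rename_i y
        obtain ⟨r, r1, r2, r3⟩ := ih x (y + 1) n m h1 h2
        refine ⟨(x, y + 1) :: r, isAlignment_cons.2 ⟨rfl, Or.inr (Or.inl rfl), ?_⟩, ?_, ?_⟩
        · rw [show y + (m + 1) = y + 1 + m by omega]; exact r1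
        · intro f g; rw [alignsAt_cons, r2]; simp
          intros; omega
        · rw [pathCost, r3]; simp [colCost]
    · simp only [List.filterMap_cons] at h1 h2
      cases n with
      | zero => simp at h1
      | succ n =>
        rw [List.range'_succ] at h1
        simp only [List.cons.injEq] at h1
        obtain ⟨rfl, h1⟩ := h1
        rename_i x
        obtain ⟨r, r1, r2, r3⟩ := ih (x + 1) y n m h1 h2
        refine ⟨(x + 1, y) :: r, isAlignment_cons.2 ⟨rfl, Or.inl rfl, ?_⟩, ?_, ?_⟩
        · rw [show x + (n + 1) = x + 1 + n by omega]; exact r1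
        · intro f g; rw [alignsAt_cons, r2]; simp
          rintro _ rfl h; omega
        · rw [pathCost, r3]; simp [colCost]
    · simp only [List.filterMap_cons] at h1 h2
      cases n with
      | zero => simp at h1
      | succ n =>
        cases m with
        | zero => simp at h2
        | succ m =>
          rw [List.range'_succ] at h1 h2
          simp only [List.cons.injEq] at h1 h2
          obtain ⟨rfl, h1⟩ := h1
          obtain ⟨rfl, h2⟩ := h2
          rename_i x y
          obtain ⟨r, r1, r2, r3⟩ := ih (x + 1) (y + 1) n m h1 h2
          refine ⟨(x + 1, y + 1) :: r, isAlignment_cons.2 ⟨rfl, Or.inr (Or.inr rfl), ?_⟩, ?_, ?_⟩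
          · rw [show x + (n + 1) = x + 1 + n by omega, show y + (m + 1) = y + 1 + m by omega]
            exact r1
          · intro f g; rw [alignsAt_cons, r2]; simp; grind
          · rw [pathCost, r3]; simp [colCost]

theorem cols_unique_fst {D : List (Option ℕ × Option ℕ)} (hD : (D.filterMap Prod.fst).Nodup)
    {f : ℕ} {b b' : Option ℕ} (h : (some f, b) ∈ D) (h' : (some f, b') ∈ D) : b = b' := by
  induction D with
  | nil => simp at h
  | cons c D ih =>
    have key : ∀ b, (some f, b) ∈ D → f ∈ D.filterMap Prod.fst := fun b hb =>
      List.mem_filterMap.2 ⟨_, hb, rfl⟩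
    rw [List.mem_cons] at h h'
    rw [List.filterMap_cons] at hD
    rcases h with h | h <;> rcases h' with h' | h'
    · rw [← h] at h'; simpa using h'.symm
    · rw [← h] at hD; simp only [List.nodup_cons] at hD; exact absurd (key _ h') hD.1
    · rw [← h'] at hD; simp only [List.nodup_cons] at hD; exact absurd (key _ h) hD.1
    · refine ih ?_ h h'
      cases hc : c.1 <;> rw [hc] at hD
      · exact hD
      · exact (List.nodup_cons.1 hD).2

theorem cols_unique_snd {D : List (Option ℕ × Option ℕ)} (hD : (D.filterMap Prod.snd).Nodup)
    {f : ℕ} {b b' : Option ℕ} (h : (b, some f) ∈ D) (h' : (b', some f) ∈ D) : b = b' := by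
  have e : (D.map Prod.swap).filterMap Prod.fst = D.filterMap Prod.snd := by
    rw [List.filterMap_map]; rfl
  exact cols_unique_fst (D := D.map Prod.swap) (f := f) (by rw [e]; exact hD)
    (List.mem_map.2 ⟨_, h, rfl⟩) (List.mem_map.2 ⟨_, h', rfl⟩)

/-- Map position columns to identifier columns. -/
def idCols {E : Type*} (N M : List E) (D : List (Option ℕ × Option ℕ)) :
    List (Option E × Option E) :=
  D.map (fun c => (c.1.bind (fun i => N[i]?), c.2.bind (fun i => M[i]?)))

theorem lift_cols {E : Type*} (N M : List E) (L : List (Option E × Option E)) :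
    ∀ x y, L.filterMap Prod.fst = N.drop x → L.filterMap Prod.snd = M.drop y →
    ∃ D, idCols N M D = L ∧ D.filterMap Prod.fst = List.range' x (N.length - x) ∧
      D.filterMap Prod.snd = List.range' y (M.length - y) := by
  have hdrop : ∀ (N : List E) (x : ℕ) (a : E) (T : List E), a :: T = N.drop x →
      N[x]? = some a ∧ T = N.drop (x + 1) ∧ N.length - x = (N.length - (x + 1)) + 1 := by
    intro N x a T h
    have hx : x < N.length := by
      by_contra hx
      rw [List.drop_of_length_le (by omega)] at h
      simp at h
    rw [List.drop_eq_getElem_cons hx] at h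
    simp only [List.cons.injEq] at h
    exact ⟨by rw [List.getElem?_eq_getElem hx, h.1], h.2, by omega⟩
  induction L with
  | nil =>
    intro x y h1 h2
    have e1 := congrArg List.length h1
    have e2 := congrArg List.length h2
    simp only [List.filterMap_nil, List.length_nil, List.length_drop] at e1 e2
    exact ⟨[], rfl, by rw [← e1]; rfl, by rw [← e2]; rfl⟩
  | cons c L ih =>
    intro x y h1 h2
    obtain ⟨a, b⟩ := c
    cases a <;> cases b
    · simp only [List.filterMap_cons] at h1 h2
      obtain ⟨D, d1, d2, d3⟩ := ih x y h1 h2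
      exact ⟨(none, none) :: D, by simp [idCols] at d1 ⊢; exact d1, by simpa using d2,
        by simpa using d3⟩
    · simp only [List.filterMap_cons] at h1 h2
      obtain ⟨b1, b2, b3⟩ := hdrop _ _ _ _ h2
      obtain ⟨D, d1, d2, d3⟩ := ih x (y + 1) h1 b2
      exact ⟨(none, some y) :: D, by simp [idCols] at d1 ⊢; exact ⟨b1, d1⟩, by simpa using d2,
        by rw [b3, List.range'_succ]; simpa using d3⟩
    · simp only [List.filterMap_cons] at h1 h2
      obtain ⟨a1, a2, a3⟩ := hdrop _ _ _ _ h1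
      obtain ⟨D, d1, d2, d3⟩ := ih (x + 1) y a2 h2
      exact ⟨(some x, none) :: D, by simp [idCols] at d1 ⊢; exact ⟨a1, d1⟩,
        by rw [a3, List.range'_succ]; simpa using d2, by simpa using d3⟩
    · simp only [List.filterMap_cons] at h1 h2
      obtain ⟨a1, a2, a3⟩ := hdrop _ _ _ _ h1
      obtain ⟨b1, b2, b3⟩ := hdrop _ _ _ _ h2
      obtain ⟨D, d1, d2, d3⟩ := ih (x + 1) (y + 1) a2 b2
      exact ⟨(some x, some y) :: D, by simp [idCols] at d1 ⊢; exact ⟨⟨a1, b1⟩, d1⟩,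
        by rw [a3, List.range'_succ]; simpa using d2,
        by rw [b3, List.range'_succ]; simpa using d3⟩

/-- Position consistency (in terms of columns) gives identifier consistency. -/
theorem idCons_of_consistent {α E : Type*} {F G : List (Paren α)} {N M : List E}
    (hF : IsForest F) (hG : IsForest G)
    (hN : Valid F N) (hM : Valid G M) {D : List (Option ℕ × Option ℕ)}
    (h1 : D.filterMap Prod.fst = List.range' 0 F.length)
    (h2 : D.filterMap Prod.snd = List.range' 0 G.length)
    (hc : ∀ f g f' g', (some f, some g) ∈ D → MateRel F f f' → MateRel G g g' →
      (some f', some g') ∈ D) : IdCons (idCols N M D) := by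
  have u1 : (D.filterMap Prod.fst).Nodup := by rw [h1]; exact List.nodup_range'
  have u2 : (D.filterMap Prod.snd).Nodup := by rw [h2]; exact List.nodup_range'
  have b1 : ∀ f b, (some f, b) ∈ D → f < F.length := by
    intro f b h
    have : f ∈ D.filterMap Prod.fst := List.mem_filterMap.2 ⟨_, h, rfl⟩
    rw [h1, List.mem_range'_1] at this; omega
  have b2 : ∀ f b, (b, some f) ∈ D → f < G.length := by
    intro f b h
    have : f ∈ D.filterMap Prod.snd := List.mem_filterMap.2 ⟨_, h, rfl⟩
    rw [h2, List.mem_range'_1] at this; omega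
  intro s t hst c hcL
  obtain ⟨⟨f, g⟩, hfg, e0⟩ := List.mem_map.1 hst
  obtain ⟨⟨f2, g2⟩, hfg2, rfl⟩ := List.mem_map.1 hcL
  simp only [Prod.mk.injEq] at e0
  cases f with
  | none => simp at e0
  | some f =>
  cases g with
  | none => simp at e0
  | some g =>
  simp only [Option.bind_some] at e0
  obtain ⟨e1, e2⟩ := e0
  have bf := b1 _ _ hfg
  have bg := b2 _ _ hfg
  obtain ⟨f', mf⟩ := mate_exists hF f bf
  obtain ⟨g', mg⟩ := mate_exists hG g bg
  have hfg' := hc f g f' g' hfg mf mg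
  have en : N[f']? = N[f]? := (hN.2 f' f (mate_lt mf).2 bf).2 (Or.inr (mate_symm mf))
  have em : M[g']? = M[g]? := (hM.2 g' g (mate_lt mg).2 bg).2 (Or.inr (mate_symm mg))
  simp only
  constructor
  · intro h
    cases f2 with
    | none => simp at h
    | some f2 =>
      simp only [Option.bind_some] at h
      rw [← e1] at h
      have bf2 := b1 _ _ hfg2
      rcases (hN.2 f2 f bf2 bf).1 h with rfl | h
      · rw [cols_unique_fst u1 hfg2 hfg]; exact e2
      · have := mate_unique (mate_symm h) mf
        subst this
        rw [cols_unique_fst u1 hfg2 hfg']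
        simp only [Option.bind_some]
        rw [em]; exact e2
  · intro h
    cases g2 with
    | none => simp at h
    | some g2 =>
      simp only [Option.bind_some] at h
      rw [← e2] at h
      have bg2 := b2 _ _ hfg2
      rcases (hM.2 g2 g bg2 bg).1 h with rfl | h
      · rw [cols_unique_snd u2 hfg2 hfg]; exact e1
      · have := mate_unique (mate_symm h) mg
        subst this
        rw [cols_unique_snd u2 hfg2 hfg']
        simp only [Option.bind_some]
        rw [en]; exact e1

/-- Identifier consistency gives position consistency. -/
theorem consistent_of_idCons {α E : Type*} {F G : List (Paren α)} {N M : List E}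
    (hN : Valid F N) (hM : Valid G M) {D : List (Option ℕ × Option ℕ)}
    (h1 : D.filterMap Prod.fst = List.range' 0 F.length)
    (h2 : D.filterMap Prod.snd = List.range' 0 G.length)
    (hc : IdCons (idCols N M D)) :
    ∀ f g f' g', (some f, some g) ∈ D → MateRel F f f' → MateRel G g g' →
      (some f', some g') ∈ D := by
  have u1 : (D.filterMap Prod.fst).Nodup := by rw [h1]; exact List.nodup_range'
  have b2 : ∀ f b, (b, some f) ∈ D → f < G.length := by
    intro f b h
    have : f ∈ D.filterMap Prod.snd := List.mem_filterMap.2 ⟨_, h, rfl⟩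
    rw [h2, List.mem_range'_1] at this; omega
  have b1 : ∀ f b, (some f, b) ∈ D → f < F.length := by
    intro f b h
    have : f ∈ D.filterMap Prod.fst := List.mem_filterMap.2 ⟨_, h, rfl⟩
    rw [h1, List.mem_range'_1] at this; omega
  intro f g f' g' hfg mf mg
  obtain ⟨bf, bf'⟩ := mate_lt mf
  obtain ⟨bg, bg'⟩ := mate_lt mg
  have en : N[f']? = N[f]? := (hN.2 f' f bf' bf).2 (Or.inr (mate_symm mf))
  have em : M[g']? = M[g]? := (hM.2 g' g bg' bg).2 (Or.inr (mate_symm mg))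
  obtain ⟨s, hs⟩ : ∃ s, N[f]? = some s :=
    ⟨_, List.getElem?_eq_getElem (by rw [hN.1]; exact bf)⟩
  obtain ⟨t, ht⟩ : ∃ t, M[g]? = some t :=
    ⟨_, List.getElem?_eq_getElem (by rw [hM.1]; exact bg)⟩
  have hst : (some s, some t) ∈ idCols N M D :=
    List.mem_map.2 ⟨_, hfg, by simp [hs, ht]⟩
  have m1 : f' ∈ D.filterMap Prod.fst := by rw [h1, List.mem_range'_1]; omega
  have m2 : g' ∈ D.filterMap Prod.snd := by rw [h2, List.mem_range'_1]; omega
  obtain ⟨⟨fa, ga⟩, hga, ea⟩ := List.mem_filterMap.1 m1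
  obtain ⟨⟨fb, gb⟩, hfb, eb⟩ := List.mem_filterMap.1 m2
  simp only at ea eb
  subst ea eb
  have ca := (hc s t hst _ (List.mem_map.2 ⟨_, hga, rfl⟩)).1 (by simp [en, hs])
  have cb := (hc s t hst _ (List.mem_map.2 ⟨_, hfb, rfl⟩)).2 (by simp [em, ht])
  simp only at ca cb
  cases ga with
  | none => simp at ca
  | some ga =>
  cases fb with
  | none => simp at cb
  | some fb =>
  simp only [Option.bind_some] at ca cb
  rcases (hM.2 ga g (b2 _ _ hga) bg).1 (by rw [ca, ht]) with rfl | h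
  · rcases (hN.2 fb f (b1 _ _ hfb) bf).1 (by rw [cb, hs]) with rfl | h
    · have := cols_unique_fst u1 hfg hfb
      simp only [Option.some.injEq] at this
      exact absurd this (mate_ne mg)
    · rw [mate_unique mf (mate_symm h)]; exact hfb
  · rw [mate_unique mg (mate_symm h)]; exact hga

theorem cols_append (v : ℕ × ℕ) (r : List (ℕ × ℕ)) : ∀ p, cols (p ++ v :: r)
    = cols (p ++ [v]) ++ cols (v :: r) := by
  intro p
  induction p with
  | nil => rfl
  | cons a p ih =>
    cases p with
    | nil => simp [cols]
    | cons b p =>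
      simp only [List.cons_append, cols] at ih ⊢
      rw [ih]

theorem isAlignment_split {x' y' : ℕ} {v : ℕ × ℕ} {r : List (ℕ × ℕ)} : ∀ {p},
    ∀ {x y : ℕ}, IsAlignment x x' y y' (p ++ v :: r) → IsAlignment x v.1 y v.2 (p ++ [v]) ∧
      IsAlignment v.1 x' v.2 y' (v :: r) := by
  intro p
  induction p with
  | nil =>
    intro x y h
    have hv : v = (x, y) := by
      have := h.1; simpa using this
    subst hv
    exact ⟨isAlignment_single.2 ⟨rfl, rfl⟩, h⟩
  | cons a p ih =>
    intro x y h
    cases p with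
    | nil =>
      obtain ⟨rfl, hs, hr⟩ := isAlignment_cons.1 h
      exact ⟨isAlignment_cons.2 ⟨rfl, hs, isAlignment_single.2 ⟨rfl, rfl⟩⟩, hr⟩
    | cons b p =>
      obtain ⟨rfl, hs, hr⟩ := isAlignment_cons.1 h
      obtain ⟨i1, i2⟩ := ih hr
      exact ⟨isAlignment_cons.2 ⟨rfl, hs, i1⟩, i2⟩

/-! ### Part 4: transferring alignments -/

/-- Label of an identifier. -/
def nlab {α : Type*} (e : NId α) : Option α := e.2.2

/-- The identifiers carry the right labels. -/
def LblOk {α : Type*} (X : List (Paren α)) (N : List (NId α)) : Prop :=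
  N.map nlab = X.map (fun c => some c.2)

theorem lblOk_annot {α : Type*} (tag : Bool) (X : List (Paren α)) : LblOk X (annot tag X) := by
  unfold LblOk
  apply List.ext_getElem?
  intro i
  rcases Nat.lt_or_ge i X.length with h | h
  · rw [List.getElem?_map, annot_getElem? _ _ _ h, List.getElem?_map,
      List.getElem?_eq_getElem h]
    simp [nlab, lbl, h]
  · rw [List.getElem?_eq_none (by simpa [annot] using h), List.getElem?_eq_none (by simpa using h)]

theorem lblOk_lbl {α : Type*} {X : List (Paren α)} {N : List (NId α)} (h : LblOk X N) (i : ℕ) :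
    lbl X i = (N[i]?).bind nlab := by
  have := congrArg (fun l => l[i]?) h
  simp only [List.getElem?_map] at this
  unfold lbl
  cases h1 : N[i]? <;> cases h2 : X[i]? <;> rw [h1, h2] at this <;> simp at this ⊢
  exact this.symm

theorem colCost_idCols {α : Type*} (w : Option α → Option α → ℝ≥0) {F G : List (Paren α)}
    {N M : List (NId α)} (hN : LblOk F N) (hM : LblOk G M) (D : List (Option ℕ × Option ℕ)) :
    colCost w nlab nlab (idCols N M D) = colCost w (lbl F) (lbl G) D := by
  unfold colCost idCols
  rw [List.map_map]
  congr 2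
  funext c
  simp only [Function.comp, Option.bind_assoc, lblOk_lbl hN, lblOk_lbl hM]

theorem range'_filterMap {E : Type*} (N : List E) (a n : ℕ) :
    (List.range' a n).filterMap (fun i => N[i]?) = (N.drop a).take n := by
  induction n generalizing a with
  | zero => simp
  | succ n ih =>
    rw [List.range'_succ, List.filterMap_cons, ih]
    rcases Nat.lt_or_ge a N.length with h | h
    · rw [List.getElem?_eq_getElem h, List.drop_eq_getElem_cons h, List.take_succ_cons]
    · rw [List.getElem?_eq_none h, List.drop_of_length_le h, List.drop_of_length_le (by omega)]
      simp

theorem idCols_fst {E : Type*} (N M : List E) (D : List (Option ℕ × Option ℕ)) :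
    (idCols N M D).filterMap Prod.fst = (D.filterMap Prod.fst).filterMap (fun i => N[i]?) := by
  rw [idCols, List.filterMap_map, List.filterMap_filterMap]
  rfl

theorem idCols_snd {E : Type*} (N M : List E) (D : List (Option ℕ × Option ℕ)) :
    (idCols N M D).filterMap Prod.snd = (D.filterMap Prod.snd).filterMap (fun i => M[i]?) := by
  rw [idCols, List.filterMap_map, List.filterMap_filterMap]
  rfl

theorem take_three {E : Type*} (N1 NP N2 : List E) (l x : ℕ) (hl : N1.length = l)
    (hx : x ≤ NP.length) : (N1 ++ NP ++ N2).take (l + x) = N1 ++ NP.take x := by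
  subst hl
  rw [List.append_assoc, List.take_length_add_append, List.take_append_of_le_length hx]

theorem drop_three {E : Type*} (N1 NP N2 : List E) (l x : ℕ) (hl : N1.length = l)
    (hx : x ≤ NP.length) : (N1 ++ NP ++ N2).drop (l + x) = NP.drop x ++ N2 := by
  subst hl
  rw [List.append_assoc, List.drop_length_add_append, List.drop_append_of_le_length hx]

theorem transfer {α : Type*} (w : Option α → Option α → ℝ≥0) (hn : Normalized w)
    (hq : Quasimetric w) {P P' F1 F2 G1 G2 : List (Paren α)} (hP : IsForest P)
    (hP' : IsForest P') (hF : IsForest (F1 ++ P ++ F2)) (hG : IsForest (G1 ++ P ++ G2))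
    {p : List (ℕ × ℕ)}
    (hp : IsAlignment 0 (F1 ++ P ++ F2).length 0 (G1 ++ P ++ G2).length p)
    (hc : Consistent (F1 ++ P ++ F2) (G1 ++ P ++ G2) p)
    {x : ℕ} (hx : x ≤ P.length) (hmem : (F1.length + x, G1.length + x) ∈ p) :
    ∃ p', IsAlignment 0 (F1 ++ P' ++ F2).length 0 (G1 ++ P' ++ G2).length p' ∧
      Consistent (F1 ++ P' ++ F2) (G1 ++ P' ++ G2) p' ∧
      pathCost w (F1 ++ P' ++ F2) (G1 ++ P' ++ G2) p' ≤
        pathCost w (F1 ++ P ++ F2) (G1 ++ P ++ G2) p := by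
  have ann : ∀ A B : List (Paren α), IsForest (A ++ P ++ B) → ∃ N1 N2 : List (NId α),
      N1.length = A.length ∧ Valid (A ++ B) (N1 ++ N2) ∧ LblOk A N1 ∧ LblOk B N2 ∧
      ∀ e ∈ N1 ++ N2, e.1 = true := by
    intro A B hAB
    have hv := annot_valid true ((forest_remove hP A B).1 hAB)
    refine ⟨(annot true (A ++ B)).take A.length, (annot true (A ++ B)).drop A.length, ?_, ?_, ?_, ?_,
      ?_⟩
    · simp [annot]
    · rw [List.take_append_drop]; exact hv
    · have := lblOk_annot true (A ++ B)
      unfold LblOk at this ⊢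
      rw [List.map_take, this]; simp
    · have := lblOk_annot true (A ++ B)
      unfold LblOk at this ⊢
      rw [List.map_drop, this]; simp
    · rw [List.take_append_drop]; exact annot_tag true _
  obtain ⟨N1, N2, n1, n2, n3, n4, n5⟩ := ann F1 F2 hF
  obtain ⟨M1, M2, m1, m2, m3, m4, m5⟩ := ann G1 G2 hG
  have fresh : ∀ Q : List (Paren α), (∀ e ∈ annot false Q, e ∉ N1 ++ N2) ∧
      (∀ e ∈ annot false Q, e ∉ M1 ++ M2) := by
    intro Q
    constructor
    · intro e he he'
      have h1 := annot_tag _ _ e he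
      have h2 := n5 e he'
      rw [h1] at h2; simp at h2
    · intro e he he'
      have h1 := annot_tag _ _ e he
      have h2 := m5 e he'
      rw [h1] at h2; simp at h2
  have lok : ∀ (A Q B : List (Paren α)) (K1 K2 : List (NId α)), LblOk A K1 → LblOk B K2 →
      LblOk (A ++ Q ++ B) (K1 ++ annot false Q ++ K2) := by
    intro A Q B K1 K2 h1 h2
    have h3 := lblOk_annot false Q
    unfold LblOk at *
    simp only [List.map_append, h1, h2, h3]
  have vF := valid_ins hP n2 n1 (annot_valid false hP) (fresh P).1
  have vG := valid_ins hP m2 m1 (annot_valid false hP) (fresh P).2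
  have vF' := valid_ins hP' n2 n1 (annot_valid false hP') (fresh P').1
  have vG' := valid_ins hP' m2 m1 (annot_valid false hP') (fresh P').2
  set NP := annot false P with hNP
  set NP' := annot false P' with hNP'
  have lNP : NP.length = P.length := (annot_valid false hP).1
  -- split the path
  obtain ⟨p0, p1, rfl⟩ := List.append_of_mem hmem
  obtain ⟨a0, a1⟩ := isAlignment_split hp
  obtain ⟨c0, c1, c2, c3, c4, c5⟩ := cols_proj a0
  obtain ⟨d0, d1, d2, d3, d4, d5⟩ := cols_proj a1
  obtain ⟨q0, q1, q2, q3, q4, q5⟩ := cols_proj hp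
  have hid : IdCons (idCols (N1 ++ NP ++ N2) (M1 ++ NP ++ M2)
      (cols (p0 ++ (F1.length + x, G1.length + x) :: p1))) := by
    apply idCons_of_consistent hF hG vF vG
    · rw [q4]; congr 1; omega
    · rw [q5]; congr 1; omega
    · intro f g f' g' h h1 h2
      rw [← cols_aligns hp] at h ⊢
      exact hc f g f' g' h h1 h2
  have hcost := colCost_idCols w (lok F1 P F2 N1 N2 n3 n4) (lok G1 P G2 M1 M2 m3 m4)
    (cols (p0 ++ (F1.length + x, G1.length + x) :: p1))
  rw [← cols_cost w _ _ hp] at hcost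
  rw [← hNP] at hcost
  rw [cols_append] at hid hcost
  have happ : ∀ A B, idCols (N1 ++ NP ++ N2) (M1 ++ NP ++ M2) (A ++ B) =
    idCols (N1 ++ NP ++ N2) (M1 ++ NP ++ M2) A ++ idCols (N1 ++ NP ++ N2) (M1 ++ NP ++ M2) B := by
    intro A B; simp [idCols]
  rw [happ] at hid hcost
  simp only at c2 c3 d2 d3
  have lenF := vF.1
  have lenG := vG.1
  obtain ⟨L0, L1, r1, r2, r3, r4, r5, r6⟩ := elim_common w hn hq nlab N1 N2 M1 M2
    _ (NP.take x) (NP.drop x) _ _ le_rfl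
    (by
      rw [idCols_fst, c4, range'_filterMap, List.drop_zero, ← take_three N1 NP N2 F1.length x n1 (by omega)]
      congr 1; omega)
    (by
      rw [idCols_snd, c5, range'_filterMap, List.drop_zero, ← take_three M1 NP M2 G1.length x m1 (by omega)]
      congr 1; omega)
    (by
      rw [idCols_fst, d4, range'_filterMap, drop_three N1 NP N2 F1.length x n1 (by omega),
        List.take_of_length_le]
      rw [← drop_three N1 NP N2 F1.length x n1 (by omega), List.length_drop]
      omega)
    (by
      rw [idCols_snd, d5, range'_filterMap, drop_three M1 NP M2 G1.length x m1 (by omega),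
        List.take_of_length_le]
      rw [← drop_three M1 NP M2 G1.length x m1 (by omega), List.length_drop]
      omega)
    (by
      rw [List.take_append_drop]
      intro e he
      have h1 := (fresh P).1 e he
      have h2 := (fresh P).2 e he
      simp only [List.mem_append, not_or] at h1 h2
      exact ⟨h1.1, h1.2, h2.1, h2.2⟩)
    hid
  rw [hcost] at r6
  -- insert the identity on P'
  set L := L0 ++ NP'.map (fun e => (some e, some e)) ++ L1 with hL
  have hLcost : colCost w nlab nlab L = colCost w nlab nlab (L0 ++ L1) := by
    have : ∀ K : List (NId α), ((K.map (fun e => ((some e : Option (NId α)), some e))).map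
      (fun c => (1 / 2 : ℝ≥0) * w (c.1.bind nlab) (c.2.bind nlab))).sum = 0 := by
      intro K
      apply List.sum_eq_zero
      intro y hy
      simp only [List.map_map, List.mem_map, Function.comp] at hy
      obtain ⟨e, -, rfl⟩ := hy
      simp [hn.1]
    simp only [colCost, hL, List.map_append, List.sum_append, this, add_zero]
  have hLid : IdCons L := by
    have memN : ∀ c ∈ L0 ++ L1, ∀ e, c.1 = some e → e ∈ N1 ++ N2 := by
      intro c hcL e he
      rw [← r1, ← r3, ← List.filterMap_append]
      exact List.mem_filterMap.2 ⟨c, hcL, he⟩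
    have memM : ∀ c ∈ L0 ++ L1, ∀ e, c.2 = some e → e ∈ M1 ++ M2 := by
      intro c hcL e he
      rw [← r2, ← r4, ← List.filterMap_append]
      exact List.mem_filterMap.2 ⟨c, hcL, he⟩
    have memL : ∀ c, c ∈ L ↔ c ∈ L0 ++ L1 ∨ ∃ e ∈ NP', (some e, some e) = c := by
      intro c
      simp only [hL, List.mem_append, List.mem_map]
      rw [or_right_comm]
    intro s t hst c hcL
    rcases (memL _).1 hst with h | ⟨e, he, h⟩ <;> rcases (memL _).1 hcL with h' | ⟨e', he', h'⟩
    · exact r5 s t h c h'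
    · subst h'
      have u1 := memN _ h s rfl
      have u2 := memM _ h t rfl
      constructor
      · intro h3
        simp only [Option.some.injEq] at h3
        exact absurd (h3 ▸ u1) ((fresh P').1 e' he')
      · intro h3
        simp only [Option.some.injEq] at h3
        exact absurd (h3 ▸ u2) ((fresh P').2 e' he')
    · simp only [Prod.mk.injEq, Option.some.injEq] at h
      obtain ⟨rfl, rfl⟩ := h
      constructor
      · intro h3
        exact absurd (memN _ h' _ h3) ((fresh P').1 e he)
      · intro h3
        exact absurd (memM _ h' _ h3) ((fresh P').2 e he)
    · simp only [Prod.mk.injEq, Option.some.injEq] at h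
      obtain ⟨rfl, rfl⟩ := h
      subst h'
      rfl
  have pid1 : ∀ K : List (NId α), (K.map (fun e => ((some e : Option (NId α)), some e))).filterMap
      Prod.fst = K := by
    intro K
    rw [List.filterMap_map]
    exact List.filterMap_some
  have pid2 : ∀ K : List (NId α), (K.map (fun e => ((some e : Option (NId α)), some e))).filterMap
      Prod.snd = K := by
    intro K
    rw [List.filterMap_map]
    exact List.filterMap_some
  obtain ⟨D, e1, e2, e3⟩ := lift_cols (N1 ++ NP' ++ N2) (M1 ++ NP' ++ M2) L 0 0
    (by rw [hL, List.filterMap_append, List.filterMap_append, r1, r3, pid1, List.drop_zero])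
    (by rw [hL, List.filterMap_append, List.filterMap_append, r2, r4, pid2, List.drop_zero])
  rw [vF'.1, Nat.sub_zero] at e2
  rw [vG'.1, Nat.sub_zero] at e3
  obtain ⟨r, f1, f2, f3⟩ := path_of_cols w hn (F1 ++ P' ++ F2) (G1 ++ P' ++ G2) D 0 0 _ _ e2 e3
  simp only [Nat.zero_add] at f1
  refine ⟨_, f1, ?_, ?_⟩
  · intro f g f' g' h h1 h2
    rw [f2] at h ⊢
    exact consistent_of_idCons vF' vG' e2 e3 (by rw [e1]; exact hLid) f g f' g' h h1 h2
  · rw [f3, ← colCost_idCols w (lok F1 P' F2 N1 N2 n3 n4) (lok G1 P' G2 M1 M2 m3 m4), ← hNP', e1,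
      hLcost]
    exact r6

/-! ### Part 5: forcing -/

/-- A walk: an alignment presented by coordinate functions with a count of bad steps. -/
structure Walk {α : Type*} (X Y : List (Paren α)) (k n : ℕ) (u v B : ℕ → ℕ) : Prop where
  u0 : u 0 = 0
  v0 : v 0 = 0
  un : u n = X.length
  vn : v n = Y.length
  B0 : B 0 = 0
  Bn : B n ≤ 2 * k
  step : ∀ t, t < n →
    (u (t + 1) = u t + 1 ∧ v (t + 1) = v t ∧ B (t + 1) = B t + 1) ∨
    (u (t + 1) = u t ∧ v (t + 1) = v t + 1 ∧ B (t + 1) = B t + 1) ∨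
    (u (t + 1) = u t + 1 ∧ v (t + 1) = v t + 1 ∧ B t ≤ B (t + 1) ∧
      (B (t + 1) = B t → lbl X (u t) = lbl Y (v t)))
  cons : ∀ t, t < n → u (t + 1) = u t + 1 → v (t + 1) = v t + 1 → ∀ f g,
    MateRel X (u t) f → MateRel Y (v t) g →
    ∃ s, s < n ∧ u s = f ∧ v s = g ∧ u (s + 1) = f + 1 ∧ v (s + 1) = g + 1

theorem Walk.swap {α : Type*} {X Y : List (Paren α)} {k n : ℕ} {u v B : ℕ → ℕ}
    (W : Walk X Y k n u v B) : Walk Y X k n v u B where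
  u0 := W.v0
  v0 := W.u0
  un := W.vn
  vn := W.un
  B0 := W.B0
  Bn := W.Bn
  step := by
    intro t ht
    rcases W.step t ht with h | h | h
    · right; left; omega
    · left; omega
    · right; right; exact ⟨h.2.1, h.1, h.2.2.1, fun e => (h.2.2.2 e).symm⟩
  cons := by
    intro t ht h1 h2 f g hf hg
    obtain ⟨s, a, b, c, d, e⟩ := W.cons t ht h2 h1 g f hg hf
    exact ⟨s, a, c, b, e, d⟩

theorem Walk.mono {α : Type*} {X Y : List (Paren α)} {k n : ℕ} {u v B : ℕ → ℕ}
    (W : Walk X Y k n u v B) (s d : ℕ) (h : s + d ≤ n) :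
    u s ≤ u (s + d) ∧ v s ≤ v (s + d) ∧ B s ≤ B (s + d) := by
  induction d with
  | zero => simp
  | succ d ih =>
    have := ih (by omega)
    have e : s + (d + 1) = s + d + 1 := by omega
    rw [e]
    rcases W.step (s + d) (by omega) with h | h | h <;> omega

theorem Walk.mono' {α : Type*} {X Y : List (Paren α)} {k n : ℕ} {u v B : ℕ → ℕ}
    (W : Walk X Y k n u v B) {s t : ℕ} (h : s ≤ t) (ht : t ≤ n) :
    u s ≤ u t ∧ v s ≤ v t ∧ B s ≤ B t := by
  have := W.mono s (t - s) (by omega)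
  rwa [show s + (t - s) = t by omega] at this

theorem Walk.width {α : Type*} {X Y : List (Paren α)} {k n : ℕ} {u v B : ℕ → ℕ}
    (W : Walk X Y k n u v B) (t : ℕ) (h : t ≤ n) :
    u t ≤ v t + B t ∧ v t ≤ u t + B t := by
  induction t with
  | zero => rw [W.u0, W.v0]; omega
  | succ t ih =>
    have := ih (by omega)
    rcases W.step t (by omega) with h | h | h <;> omega

theorem Walk.const {α : Type*} {X Y : List (Paren α)} {k n : ℕ} {u v B : ℕ → ℕ}
    (W : Walk X Y k n u v B) (s d : ℕ) (h : s + d ≤ n) (hB : B s = B (s + d)) :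
    u (s + d) = u s + d ∧ v (s + d) = v s + d := by
  induction d with
  | zero => simp
  | succ d ih =>
    have h1 := W.mono s d (by omega)
    have e : s + (d + 1) = s + d + 1 := by omega
    rw [e] at hB ⊢
    rcases W.step (s + d) (by omega) with h | h | h
    · omega
    · omega
    · have := ih (by omega)
      omega

theorem Walk.exists_u {α : Type*} {X Y : List (Paren α)} {k n : ℕ} {u v B : ℕ → ℕ}
    (W : Walk X Y k n u v B) (x : ℕ) (hx : x ≤ X.length) : ∃ t, t ≤ n ∧ u t = x := by
  induction x with
  | zero => exact ⟨0, by omega, W.u0⟩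
  | succ x ih =>
    by_contra hcon
    push Not at hcon
    have key : ∀ t, t ≤ n → u t ≤ x := by
      intro t
      induction t with
      | zero => intro _; rw [W.u0]; omega
      | succ t iht =>
        intro h
        have h1 := iht (by omega)
        have h2 := hcon (t + 1) h
        rcases W.step t (by omega) with h | h | h <;> omega
    have := key n le_rfl
    rw [W.un] at this
    omega

/-- The walk meets the main diagonal inside the two copies of `P`. -/
def Hit (lF lG N n : ℕ) (u v : ℕ → ℕ) : Prop :=
  ∃ t, t ≤ n ∧ ∃ c, c ≤ N ∧ u t = lF + c ∧ v t = lG + c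

theorem Hit.swap {lF lG N n : ℕ} {u v : ℕ → ℕ} (h : Hit lG lF N n v u) : Hit lF lG N n u v := by
  obtain ⟨t, ht, c, hc, h1, h2⟩ := h
  exact ⟨t, ht, c, hc, h2, h1⟩

theorem Walk.ivt {α : Type*} {X Y : List (Paren α)} {k n : ℕ} {u v B : ℕ → ℕ}
    (W : Walk X Y k n u v B) (lF lG N s d : ℕ) (h : s + d ≤ n)
    (h1 : lF ≤ u s) (h2 : u (s + d) ≤ lF + N)
    (h3 : (lG + u s ≤ lF + v s ∧ lF + v (s + d) ≤ lG + u (s + d)) ∨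
      (lF + v s ≤ lG + u s ∧ lG + u (s + d) ≤ lF + v (s + d))) : Hit lF lG N n u v := by
  induction d with
  | zero =>
    simp only [add_zero] at *
    exact ⟨s, h, u s - lF, by omega, by omega, by omega⟩
  | succ d ih =>
    have e : s + (d + 1) = s + d + 1 := by omega
    rw [e] at h h2 h3
    have hm := W.mono s d (by omega)
    by_cases hz : lF + v (s + d + 1) = lG + u (s + d + 1)
    · have hm' := W.mono s (d + 1) (by omega)
      rw [e] at hm'
      exact ⟨s + d + 1, h, u (s + d + 1) - lF, by omega, by omega, by omega⟩
    · apply ih (by omega)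
      · rcases W.step (s + d) (by omega) with h | h | h <;> omega
      · rcases W.step (s + d) (by omega) with h | h | h <;> omega

/-- No hit forces the sign of the shift to be constant over the copy of `P`. -/
theorem Walk.sign {α : Type*} {X Y : List (Paren α)} {k n : ℕ} {u v B : ℕ → ℕ}
    (W : Walk X Y k n u v B) (lF lG N s t : ℕ) (hs : s ≤ n) (ht : t ≤ n)
    (s1 : lF ≤ u s) (s2 : u s ≤ lF + N) (t1 : lF ≤ u t) (t2 : u t ≤ lF + N)
    (h1 : lG + u s ≤ lF + v s) (h2 : lF + v t ≤ lG + u t) : Hit lF lG N n u v := by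
  rcases Nat.le_total s t with h | h
  · obtain ⟨d, rfl⟩ := Nat.exists_eq_add_of_le h
    exact W.ivt lF lG N s d ht s1 t2 (Or.inl ⟨h1, h2⟩)
  · obtain ⟨d, rfl⟩ := Nat.exists_eq_add_of_le h
    exact W.ivt lF lG N t d hs t1 s2 (Or.inr ⟨h2, h1⟩)

/-- Walk over the two forests around `P`, starting above the main diagonal. -/
theorem forcing_wlog {α : Type*} {P : List (Paren α)} {k : ℕ}
    (main : ∀ (F1 F2 G1 G2 : List (Paren α)) (n : ℕ) (u v B : ℕ → ℕ),
      F1.length ≤ G1.length + 2 * k → G1.length ≤ F1.length + 2 * k →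
      Walk (F1 ++ P ++ F2) (G1 ++ P ++ G2) k n u v B →
      (∀ t, t ≤ n → F1.length ≤ u t → u t ≤ F1.length + P.length →
        G1.length + u t < F1.length + v t ∧ F1.length + v t ≤ G1.length + u t + 4 * k) →
      Hit F1.length G1.length P.length n u v)
    (F1 F2 G1 G2 : List (Paren α)) (n : ℕ) (u v B : ℕ → ℕ)
    (l1 : F1.length ≤ G1.length + 2 * k) (l2 : G1.length ≤ F1.length + 2 * k)
    (W : Walk (F1 ++ P ++ F2) (G1 ++ P ++ G2) k n u v B) :
    Hit F1.length G1.length P.length n u v := by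
  have aux : ∀ (F1 F2 G1 G2 : List (Paren α)) (n : ℕ) (u v B : ℕ → ℕ),
      F1.length ≤ G1.length + 2 * k → G1.length ≤ F1.length + 2 * k →
      Walk (F1 ++ P ++ F2) (G1 ++ P ++ G2) k n u v B →
      (∃ t, t ≤ n ∧ u t = F1.length ∧ G1.length ≤ v t) →
      Hit F1.length G1.length P.length n u v := by
    intro F1 F2 G1 G2 n u v B l1 l2 W ⟨t0, h0, h1, h2⟩
    by_contra hh
    apply hh
    apply main F1 F2 G1 G2 n u v B l1 l2 W
    intro t ht t1 t2
    constructor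
    · by_contra hlt
      exact hh (W.sign _ _ _ t0 t h0 ht (by omega) (by omega) t1 t2 (by omega) (by omega))
    · have := W.width t ht
      have := (W.mono' ht le_rfl).2.2
      have := W.Bn
      omega
  obtain ⟨t0, h0, h1⟩ := W.exists_u F1.length (by simp)
  rcases Nat.lt_or_ge (v t0) G1.length with h | h
  · obtain ⟨t1, h2, h3⟩ := W.swap.exists_u G1.length (by simp)
    apply Hit.swap
    apply aux G1 G2 F1 F2 n v u B l2 l1 W.swap
    refine ⟨t1, h2, h3, ?_⟩
    rcases Nat.le_total t0 t1 with h' | h'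
    · have := W.mono' h' h2
      omega
    · have := W.mono' h' h0
      omega
  · exact aux F1 F2 G1 G2 n u v B l1 l2 W ⟨t0, h0, h1, h⟩

/-- Aligned positions whose mates are crossed towards the diagonal give a hit. -/
theorem mate_hit {α : Type*} {P F1 F2 G1 G2 : List (Paren α)} {k n : ℕ} {u v B : ℕ → ℕ}
    (W : Walk (F1 ++ P ++ F2) (G1 ++ P ++ G2) k n u v B)
    {t i d c c' : ℕ} (ht : t < n) (hu : u t = F1.length + i) (hv : v t = G1.length + (i + d))
    (su : u (t + 1) = u t + 1) (sv : v (t + 1) = v t + 1)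
    (hc : MateRel P i c) (hc' : MateRel P (i + d) c') (hle : c' ≤ c) :
    Hit F1.length G1.length P.length n u v := by
  have b1 := mate_lt hc
  have b2 := mate_lt hc'
  obtain ⟨s, s1, s2, s3, s4, s5⟩ := W.cons t ht su sv (F1.length + c) (G1.length + c')
    (by rw [hu]; exact (mate_mid _ _ _ _ _ b1.1 b1.2).2 hc)
    (by rw [hv]; exact (mate_mid _ _ _ _ _ b2.1 b2.2).2 hc')
  exact W.sign _ _ _ t s ht.le s1.le (by omega) (by omega) (by omega) (by omega) (by omega)
    (by omega)

theorem node_of_open {α : Type*} {X : List (Paren α)} {i c : ℕ} {a : α}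
    (h : MateRel X i c) (ho : X[i]? = some (true, a)) : IsNode X i c := by
  rcases h with h | h
  · exact h
  · obtain ⟨b, h1, h2⟩ := node_open h
    rw [ho] at h2; simp at h2

theorem node_of_close {α : Type*} {X : List (Paren α)} {i c : ℕ} {a : α}
    (h : MateRel X i c) (ho : X[i]? = some (false, a)) : IsNode X c i := by
  rcases h with h | h
  · obtain ⟨b, h1, h2⟩ := node_open h
    rw [ho] at h1; simp at h1
  · exact h

/-- Aligned positions with equal labels carry equal characters. -/
theorem aligned_char {α : Type*} {P F1 F2 G1 G2 : List (Paren α)} (hP : IsForest P)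
    {k n : ℕ} {u v B : ℕ → ℕ}
    (W : Walk (F1 ++ P ++ F2) (G1 ++ P ++ G2) k n u v B)
    {t i j : ℕ} (ht : t < n) (hu : u t = F1.length + i) (hv : v t = G1.length + j)
    (hi : i < P.length) (hj : j < P.length)
    (su : u (t + 1) = u t + 1) (sv : v (t + 1) = v t + 1)
    (hl : lbl (F1 ++ P ++ F2) (u t) = lbl (G1 ++ P ++ G2) (v t)) : P[i]? = P[j]? := by
  obtain ⟨c, hc⟩ := mate_exists hP i hi
  obtain ⟨c', hc'⟩ := mate_exists hP j hj
  have b1 := mate_lt hc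
  have b2 := mate_lt hc'
  obtain ⟨s, s1, s2, s3, s4, s5⟩ := W.cons t ht su sv (F1.length + c) (G1.length + c')
    (by rw [hu]; exact (mate_mid _ _ _ _ _ b1.1 b1.2).2 hc)
    (by rw [hv]; exact (mate_mid _ _ _ _ _ b2.1 b2.2).2 hc')
  have hne := mate_ne hc
  have hne' := mate_ne hc'
  have hdir : (i < c ↔ j < c') := by
    rcases Nat.lt_or_ge t s with h | h
    · have := W.mono' (show t + 1 ≤ s by omega) s1.le
      omega
    · have := W.mono' h ht.le
      omega
  rw [hu, hv] at hl
  unfold lbl at hl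
  rw [getElem?_mid _ _ _ _ hi, getElem?_mid _ _ _ _ hj] at hl
  rcases hc with hc | hc <;> rcases hc' with hc' | hc'
  · obtain ⟨a, h1, _⟩ := node_open hc
    obtain ⟨a', h2, _⟩ := node_open hc'
    rw [h1, h2] at hl ⊢
    simpa using hl
  · have := hc.1
    have := hc'.1
    omega
  · have := hc.1
    have := hc'.1
    omega
  · obtain ⟨a, _, h1⟩ := node_open hc
    obtain ⟨a', _, h2⟩ := node_open hc'
    rw [h1, h2] at hl ⊢
    simpa using hl

theorem first_argmin (h : ℕ → ℤ) (a d : ℕ) :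
    ∃ z, a ≤ z ∧ z ≤ a + d ∧ (∀ i, a ≤ i → i ≤ a + d → h z ≤ h i) ∧
      ∀ i, a ≤ i → i < z → h z < h i := by
  induction d with
  | zero =>
    refine ⟨a, le_rfl, le_rfl, ?_, ?_⟩
    · intro i h1 h2; rw [show i = a by omega]
    · intro i h1 h2; omega
  | succ d ih =>
    obtain ⟨z, z1, z2, z3, z4⟩ := ih
    rcases lt_or_ge (h (a + (d + 1))) (h z) with hlt | hge
    · refine ⟨a + (d + 1), by omega, le_rfl, ?_, ?_⟩
      · intro i h1 h2
        rcases Nat.lt_or_ge (a + d) i with h3 | h3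
        · rw [show i = a + (d + 1) by omega]
        · have := z3 i h1 h3; omega
      · intro i h1 h2
        have := z3 i h1 (by omega); omega
    · refine ⟨z, z1, by omega, ?_, z4⟩
      intro i h1 h2
      rcases Nat.lt_or_ge (a + d) i with h3 | h3
      · rw [show i = a + (d + 1) by omega]; exact hge
      · exact z3 i h1 h3

theorem last_argmin (h : ℕ → ℤ) (a d : ℕ) :
    ∃ z, a ≤ z ∧ z ≤ a + d ∧ (∀ i, a ≤ i → i ≤ a + d → h z ≤ h i) ∧
      ∀ i, z < i → i ≤ a + d → h z < h i := by
  induction d with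
  | zero =>
    refine ⟨a, le_rfl, le_rfl, ?_, ?_⟩
    · intro i h1 h2; rw [show i = a by omega]
    · intro i h1 h2; omega
  | succ d ih =>
    obtain ⟨z, z1, z2, z3, z4⟩ := ih
    rcases lt_or_ge (h z) (h (a + (d + 1))) with hlt | hge
    · refine ⟨z, z1, by omega, ?_, ?_⟩
      · intro i h1 h2
        rcases Nat.lt_or_ge (a + d) i with h3 | h3
        · rw [show i = a + (d + 1) by omega]; exact hlt.le
        · exact z3 i h1 h3
      · intro i h1 h2
        rcases Nat.lt_or_ge (a + d) i with h3 | h3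
        · rw [show i = a + (d + 1) by omega]; exact hlt
        · exact z4 i h1 h3
    · refine ⟨a + (d + 1), by omega, le_rfl, ?_, ?_⟩
      · intro i h1 h2
        rcases Nat.lt_or_ge (a + d) i with h3 | h3
        · rw [show i = a + (d + 1) by omega]
        · have := z3 i h1 h3; omega
      · intro i h1 h2; omega

/-- A long periodic fragment all of whose mates move in the direction of the shift has a
balanced period. -/
theorem period_balanced {α : Type*} {P : List (Paren α)} (hP : IsForest P) {a d L : ℕ}
    (hd : 0 < d) (hdL : d ≤ L) (hL : a + L + d ≤ P.length)
    (hper : ∀ i, a ≤ i → i < a + L → P[i]? = P[i + d]?)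
    (hm : ∀ i, a ≤ i → i < a + L → ∀ c c', MateRel P i c → MateRel P (i + d) c' → c < c') :
    ht (P.take (a + d)) = ht (P.take a) := by
  set h : ℕ → ℤ := fun i => ht (P.take i) with hh
  have hstep : ∀ i b x, P[i]? = some (b, x) → h (i + 1) = h i + (if b = true then (1 : ℤ) else -1) :=
    fun i b x hx => H_succ P i b x hx
  have hget : ∀ i, i < P.length → ∃ b x, P[i]? = some (b, x) := by
    intro i hi
    exact ⟨(P[i]).1, (P[i]).2, by rw [List.getElem?_eq_getElem hi]⟩
  have hshift : ∀ e, e ≤ L → h (a + e + d) = h (a + e) + (h (a + d) - h a) := by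
    intro e
    induction e with
    | zero => intro _; simp
    | succ e ih =>
      intro he
      have h1 := ih (by omega)
      obtain ⟨b, x, hb⟩ := hget (a + e) (by omega)
      have hb' := hper (a + e) (by omega) (by omega)
      rw [hb] at hb'
      have h2 := hstep _ _ _ hb
      have h3 := hstep _ _ _ hb'.symm
      rw [show a + (e + 1) + d = a + e + d + 1 by omega, show a + (e + 1) = a + e + 1 by omega]
      omega
  change h (a + d) = h a
  rcases lt_trichotomy (h (a + d)) (h a) with hlt | heq | hgt
  · exfalso
    obtain ⟨z, z1, z2, z3, z4⟩ := first_argmin h a d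
    have za : z ≠ a := by
      rintro rfl
      have := z3 (z + d) (by omega) le_rfl
      omega
    obtain ⟨q, rfl⟩ : ∃ q, z = q + 1 := ⟨z - 1, by omega⟩
    obtain ⟨b, x, hb⟩ := hget q (by omega)
    have h1 := hstep _ _ _ hb
    have h2 := z4 q (by omega) (by omega)
    have hbf : b = false := by
      cases b
      · rfl
      · simp at h1; omega
    subst hbf
    have hb' := hper q (by omega) (by omega)
    rw [hb] at hb'
    obtain ⟨o, ho⟩ := mate_exists hP q (by omega)
    obtain ⟨o', ho'⟩ := mate_exists hP (q + d) (by omega)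
    have hoo := hm q (by omega) (by omega) o o' ho ho'
    have n1 := node_of_close ho hb
    have n2 := node_of_close ho' hb'.symm
    obtain ⟨e1, e2⟩ := node_height n1
    obtain ⟨e3, e4⟩ := node_height n2
    have hs := hshift (q + 1 - a) (by omega)
    rw [show a + (q + 1 - a) = q + 1 by omega, show q + 1 + d = q + d + 1 by omega] at hs
    change h (q + 1) = h o at e1
    change h (q + d + 1) = h o' at e3
    have := n2.1
    rcases Nat.lt_or_ge q o' with g | g
    · rcases Nat.lt_or_ge (a + d) o' with g' | g'
      · have hs' := hshift (o' - d - a) (by omega)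
        rw [show a + (o' - d - a) + d = o' by omega, show a + (o' - d - a) = o' - d by omega] at hs'
        have := z4 (o' - d) (by omega) (by omega)
        omega
      · have := z3 o' (by omega) g'
        omega
    · have := e2 o' hoo g
      change h o < h o' at this
      omega
  · exact heq
  · exfalso
    obtain ⟨z, z1, z2, z3, z4⟩ := last_argmin h a d
    have za : z ≠ a + d := by
      rintro rfl
      have := z3 a (by omega) (by omega)
      omega
    obtain ⟨b, x, hb⟩ := hget z (by omega)
    have h1 := hstep _ _ _ hb
    have h2 := z4 (z + 1) (by omega) (by omega)
    have hbf : b = true := by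
      cases b
      · simp at h1; omega
      · rfl
    subst hbf
    have hb' := hper z (by omega) (by omega)
    rw [hb] at hb'
    obtain ⟨c, hc⟩ := mate_exists hP z (by omega)
    obtain ⟨c', hc'⟩ := mate_exists hP (z + d) (by omega)
    have hcc := hm z (by omega) (by omega) c c' hc hc'
    have n1 := node_of_open hc hb
    have n2 := node_of_open hc' hb'.symm
    obtain ⟨e1, e2⟩ := node_height n1
    obtain ⟨e3, e4⟩ := node_height n2
    have hs := hshift (z - a) (by omega)
    rw [show a + (z - a) = z by omega] at hs
    change h (c + 1) = h z at e1
    change h (c' + 1) = h (z + d) at e3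
    have := n1.1
    rcases Nat.lt_or_ge (z + d) (c + 1) with g | g
    · have := e4 (c + 1) g (by omega)
      change h (z + d) < h (c + 1) at this
      omega
    · rcases Nat.lt_or_ge (a + d) (c + 1) with g' | g'
      · have hs' := hshift (c + 1 - d - a) (by omega)
        rw [show a + (c + 1 - d - a) + d = c + 1 by omega,
          show a + (c + 1 - d - a) = c + 1 - d by omega] at hs'
        have := z3 (c + 1 - d) (by omega) (by omega)
        omega
      · have := z4 (c + 1) (by omega) g'
        omega

theorem ht_zero_count {α : Type*} (S : List (Paren α)) :
    ht S = (S.countP (fun c => c.1) : ℤ) - (S.countP (fun c => !c.1) : ℤ) := by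
  induction S with
  | nil => simp [ht]
  | cons c S ih =>
    rw [show c :: S = [c] ++ S from rfl, ht_append, ih, List.countP_append, List.countP_append]
    obtain ⟨b, x⟩ := c
    cases b <;> simp [ht] <;> ring

theorem block_black {α : Type*} {P : List (Paren α)} {k a d L : ℕ}
    (hd : 0 < d) (hdk : d ≤ 4 * k) (hLen : 42 * k ≤ L + d) (hL : a + L + d ≤ P.length)
    (hper : ∀ i, a ≤ i → i < a + L → P[i]? = P[i + d]?)
    (hb : ht (P.take (a + d)) = ht (P.take a)) (i : ℕ) (h1 : a + 5 * k ≤ i)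
    (h2 : i + 5 * k < a + L + d) : IsBlack k P i := by
  refine ⟨a, a + L + d, hL, h1, h2, ?_, d, hd, hdk, ?_, ?_⟩
  · simp [frag]; omega
  · intro j hj
    have hj' : j + d < L + d := by
      simp [frag] at hj; omega
    rw [frag_getElem?, frag_getElem?, if_pos (by omega), if_pos (by omega),
      hper (a + j) (by omega) (by omega)]
    congr 1; omega
  · have e : P.take (a + d) = P.take a ++ (frag P a (a + L + d)).take d := by
      rw [frag, ← List.take_append_drop a (P.take (a + d))]
      congr 1
      · rw [List.take_take]; congr 1; omega
      · rw [List.take_drop, List.take_take]; congr 2; omega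
    rw [e, ht_append] at hb
    have := ht_zero_count ((frag P a (a + L + d)).take d)
    omega

/-- Forests with many red characters force a hit. -/
theorem forcing_red {α : Type*} {P : List (Paren α)} (hP : IsForest P) {k : ℕ} (hk : 0 < k)
    (hred : 158 * k ^ 2 < redCount k P)
    (F1 F2 G1 G2 : List (Paren α)) (n : ℕ) (u v B : ℕ → ℕ)
    (l1 : F1.length ≤ G1.length + 2 * k) (l2 : G1.length ≤ F1.length + 2 * k)
    (W : Walk (F1 ++ P ++ F2) (G1 ++ P ++ G2) k n u v B) :
    Hit F1.length G1.length P.length n u v := by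
  refine forcing_wlog ?_ F1 F2 G1 G2 n u v B l1 l2 W
  clear W l1 l2 F1 F2 G1 G2 n u v B
  intro F1 F2 G1 G2 n u v B l1 l2 W hδ
  by_contra hh
  have hT : ∀ i, ∃ t, i ≤ P.length → t ≤ n ∧ u t = F1.length + i := by
    intro i
    by_cases hi : i ≤ P.length
    · obtain ⟨t, h1, h2⟩ := W.exists_u (F1.length + i) (by simp; omega)
      exact ⟨t, fun _ => ⟨h1, h2⟩⟩
    · exact ⟨0, fun h => absurd h hi⟩
  choose T hT using hT
  -- the key claim about a stretch with constant number of bad steps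
  have key : ∀ a b, a ≤ b → b + 4 * k ≤ P.length → B (T a) = B (T b) →
      ∀ i, a + 5 * k ≤ i → i + 5 * k ≤ b → a + 42 * k ≤ b → IsBlack k P i := by
    intro a b hab hb hB i hi1 hi2 hab'
    obtain ⟨ta, ua⟩ := hT a (by omega)
    obtain ⟨tb, ub⟩ := hT b (by omega)
    have hle : T a ≤ T b := by
      by_contra hlt
      have := W.mono' (show T b ≤ T a by omega) ta
      omega
    obtain ⟨D, hD⟩ := Nat.exists_eq_add_of_le hle
    have hcD := W.const (T a) D (by omega) (by rw [← hD]; exact hB)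
    have hDL : D = b - a := by rw [← hD] at hcD; omega
    obtain ⟨d1, d2⟩ := hδ (T a) ta (by omega) (by omega)
    obtain ⟨d, hd⟩ : ∃ d, v (T a) = G1.length + (a + d) := ⟨v (T a) - G1.length - a, by omega⟩
    have hall : ∀ j, j < D → u (T a + j) = F1.length + (a + j) ∧
        v (T a + j) = G1.length + (a + j + d) ∧ u (T a + j + 1) = u (T a + j) + 1 ∧
        v (T a + j + 1) = v (T a + j) + 1 ∧
        lbl (F1 ++ P ++ F2) (u (T a + j)) = lbl (G1 ++ P ++ G2) (v (T a + j)) := by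
      intro j hj
      have m1 := W.mono' (show T a ≤ T a + j by omega) (by omega)
      have m2 := W.mono' (show T a + j ≤ T a + j + 1 by omega) (by omega)
      have m3 := W.mono' (show T a + j + 1 ≤ T a + D by omega) (by omega)
      rw [← hD] at m3
      have c1 := W.const (T a) j (by omega) (by omega)
      rcases W.step (T a + j) (by omega) with h | h | h
      · omega
      · omega
      · exact ⟨by omega, by omega, h.1, h.2.1, h.2.2.2 (by omega)⟩
    have hper : ∀ i, a ≤ i → i < a + D → P[i]? = P[i + d]? := by
      intro i h1 h2
      obtain ⟨q1, q2, q3, q4, q5⟩ := hall (i - a) (by omega)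
      rw [show a + (i - a) = i by omega] at q1 q2
      exact aligned_char hP W (t := T a + (i - a)) (by omega) q1 q2 (by omega) (by omega) q3 q4 q5
    have hbal := period_balanced hP (a := a) (d := d) (L := D) (by omega) (by omega) (by omega) hper
      (by
        intro i h1 h2 c c' hc hc'
        by_contra hcc
        obtain ⟨q1, q2, q3, q4, q5⟩ := hall (i - a) (by omega)
        rw [show a + (i - a) = i by omega] at q1 q2
        exact hh (mate_hit W (t := T a + (i - a)) (by omega) q1 q2 q3 q4 hc hc' (by omega)))
    exact block_black (by omega) (by omega) (by omega) (by omega) hper hbal i hi1 (by omega)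
  set R := (Finset.range P.length).filter (fun i => ¬ IsBlack k P i) with hR
  set R0 := R.filter (fun i => i + 4 * k ≤ P.length) with hR0
  have hR0le : R0.card ≤ 42 * k * (Finset.range (2 * k + 1)).card := by
    apply Finset.card_le_mul_card_image_of_maps_to (f := fun i => B (T i))
    · intro i hi
      simp only [hR0, hR, Finset.mem_filter, Finset.mem_range] at hi
      obtain ⟨t1, _⟩ := hT i (by omega)
      have := (W.mono' t1 le_rfl).2.2
      have := W.Bn
      rw [Finset.mem_range]
      omega
    · intro q hq
      set S := R0.filter (fun i => B (T i) = q) with hS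
      rcases S.eq_empty_or_nonempty with he | hne
      · rw [he]; simp
      · have ha := S.min'_mem hne
        have hb := S.max'_mem hne
        have hbd : ∀ i ∈ S, S.min' hne ≤ i ∧ i ≤ S.max' hne :=
          fun i hi => ⟨S.min'_le i hi, S.le_max' i hi⟩
        set a := S.min' hne
        set b := S.max' hne
        have hmem : ∀ i ∈ S, ¬ IsBlack k P i ∧ i + 4 * k ≤ P.length ∧ B (T i) = q := by
          intro i hi
          simp only [hS, hR0, hR, Finset.mem_filter, Finset.mem_range] at hi
          exact ⟨hi.1.1.2, hi.1.2, hi.2⟩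
        have hab := (hbd a ha).2
        rcases Nat.lt_or_ge b (a + 42 * k) with h | h
        · calc S.card ≤ (Finset.Ico a (a + 42 * k)).card := by
                apply Finset.card_le_card
                intro i hi
                have := hbd i hi
                rw [Finset.mem_Ico]; omega
            _ = 42 * k := by simp
        · calc S.card ≤ (Finset.Ico a (a + 5 * k) ∪ Finset.Ico (b + 1 - 5 * k) (b + 1)).card := by
                apply Finset.card_le_card
                intro i hi
                have h1 := hbd i hi
                rw [Finset.mem_union, Finset.mem_Ico, Finset.mem_Ico]
                by_contra hcon
                exact (hmem i hi).1 (key a b hab (hmem b hb).2.1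
                  (by rw [(hmem a ha).2.2, (hmem b hb).2.2]) i (by omega) (by omega) h)
            _ ≤ 5 * k + 5 * k := by
                refine (Finset.card_union_le _ _).trans ?_
                simp only [Nat.card_Ico]; omega
            _ ≤ 42 * k := by omega
  have hRle : R.card ≤ R0.card + 4 * k := by
    rw [← Finset.card_filter_add_card_filter_not (s := R) (fun i => i + 4 * k ≤ P.length)]
    apply Nat.add_le_add_left
    calc (R.filter (fun i => ¬ (i + 4 * k ≤ P.length))).card
        ≤ (Finset.Ico (P.length - 4 * k) P.length).card := by
          apply Finset.card_le_card
          intro i hi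
          simp only [hR, Finset.mem_filter, Finset.mem_range] at hi
          rw [Finset.mem_Ico]; omega
      _ ≤ 4 * k := by simp only [Nat.card_Ico]; omega
  have : redCount k P = R.card := rfl
  rw [Finset.card_range] at hR0le
  nlinarith

/-- The replacement forest. -/
def spine {α : Type*} (x : α) (m : ℕ) : List (Paren α) :=
  List.replicate m (true, x) ++ List.replicate m (false, x)

theorem spine_forest {α : Type*} (x : α) (m : ℕ) : IsForest (spine x m) := by
  induction m with
  | zero => exact IsForest.nil
  | succ m ih =>
    have := IsForest.wrap x ih
    have e : spine x (m + 1) = (true, x) :: spine x m ++ [(false, x)] := by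
      unfold spine
      rw [List.replicate_succ, List.replicate_succ']
      simp
    rw [e]; exact this

theorem spine_length {α : Type*} (x : α) (m : ℕ) : (spine x m).length = 2 * m := by
  simp [spine]; omega

theorem spine_mate {α : Type*} (x : α) (m i : ℕ) (hi : i < m) :
    MateRel (spine x m) i (2 * m - 1 - i) := by
  left
  refine ⟨by omega, by rw [spine_length]; omega, ⟨x, ?_, ?_⟩, ?_⟩
  · unfold spine
    rw [List.getElem?_append_left (by simpa using hi)]
    simp [hi]
  · unfold spine
    rw [List.getElem?_append_right (by simp; omega)]
    rw [List.length_replicate, List.getElem?_replicate, if_pos (by omega)]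
  · have : frag (spine x m) (i + 1) (2 * m - 1 - i) = spine x (m - 1 - i) := by
      apply List.ext_getElem?
      intro q
      rw [frag_getElem?]
      unfold spine
      simp only [List.getElem?_append, List.length_replicate, List.getElem?_replicate]
      split_ifs <;> first | rfl | omega
    rw [this]; exact spine_forest _ _

theorem forcing_spine {α : Type*} (x : α) {k m : ℕ} (hm : 6 * k < m)
    (F1 F2 G1 G2 : List (Paren α)) (n : ℕ) (u v B : ℕ → ℕ)
    (l1 : F1.length ≤ G1.length + 2 * k) (l2 : G1.length ≤ F1.length + 2 * k)
    (W : Walk (F1 ++ spine x m ++ F2) (G1 ++ spine x m ++ G2) k n u v B) :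
    Hit F1.length G1.length (spine x m).length n u v := by
  refine forcing_wlog ?_ F1 F2 G1 G2 n u v B l1 l2 W
  clear W l1 l2 F1 F2 G1 G2 n u v B
  intro F1 F2 G1 G2 n u v B l1 l2 W hδ
  have hlen := spine_length x m
  have hT : ∀ i, ∃ t, i ≤ (spine x m).length → t ≤ n ∧ u t = F1.length + i := by
    intro i
    by_cases hi : i ≤ (spine x m).length
    · obtain ⟨t, h1, h2⟩ := W.exists_u (F1.length + i) (by simp; omega)
      exact ⟨t, fun _ => ⟨h1, h2⟩⟩
    · exact ⟨0, fun h => absurd h hi⟩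
  choose T hT using hT
  have main : ∀ a b, a < b → b ≤ 2 * k + 1 → B (T a) = B (T b) →
      Hit F1.length G1.length (spine x m).length n u v := by
    intro a b hab hb hB
    obtain ⟨ta, ua⟩ := hT a (by omega)
    obtain ⟨tb, ub⟩ := hT b (by omega)
    have hle : T a < T b := by
      by_contra hlt
      have := W.mono' (show T b ≤ T a by omega) ta
      omega
    obtain ⟨d1, d2⟩ := hδ (T a) ta (by omega) (by omega)
    obtain ⟨d, hd⟩ : ∃ d, v (T a) = G1.length + (a + d) := ⟨v (T a) - G1.length - a, by omega⟩
    have m3 := W.mono' (show T a + 1 ≤ T b by omega) tb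
    have hs : u (T a + 1) = u (T a) + 1 ∧ v (T a + 1) = v (T a) + 1 := by
      rcases W.step (T a) (by omega) with h | h | h <;> omega
    exact mate_hit W (by omega) ua hd hs.1 hs.2 (spine_mate x m a (by omega))
      (spine_mate x m (a + d) (by omega)) (by omega)
  obtain ⟨a, ha, b, hb, hne, he⟩ := Finset.exists_ne_map_eq_of_card_lt_of_maps_to
    (s := Finset.range (2 * k + 2)) (t := Finset.range (2 * k + 1)) (f := fun i => B (T i))
    (by simp) (by
      intro i hi
      simp only [Finset.coe_range, Set.mem_Iio] at hi ⊢
      obtain ⟨t1, _⟩ := hT i (by omega)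
      have := (W.mono' t1 le_rfl).2.2
      have := W.Bn
      omega)
  rw [Finset.mem_range] at ha hb
  rcases Nat.lt_or_ge a b with h | h
  · exact main a b h (by omega) he
  · exact main b a (by omega) (by omega) he.symm

/-! ### Part 6: conclusion -/

/-- Indicator of a step that is not a diagonal step between equal labels. -/
noncomputable def bad {α : Type*} (X Y : List (Paren α)) (p q : ℕ × ℕ) : ℕ :=
  if q = (p.1 + 1, p.2 + 1) ∧ lbl X p.1 = lbl Y p.2 then 0 else 1

theorem lbl_ne_none {α : Type*} {X : List (Paren α)} {i : ℕ} (h : i < X.length) :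
    lbl X i ≠ none := by
  unfold lbl
  rw [List.getElem?_eq_getElem h]
  simp

theorem bad_cost {α : Type*} (w : Option α → Option α → ℝ≥0) (hn : Normalized w)
    (X Y : List (Paren α)) (p : List (ℕ × ℕ)) : ∀ x x' y y' : ℕ, IsAlignment x x' y y' p →
    x' ≤ X.length → y' ≤ Y.length →
    ((∑ s ∈ Finset.range (p.length - 1), bad X Y (p.getD s (0, 0)) (p.getD (s + 1) (0, 0)) : ℕ) : ℝ≥0)
      ≤ 2 * pathCost w X Y p := by
  induction p with
  | nil => intro x x' y y' h; exact absurd h not_isAlignment_nil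
  | cons p r ih =>
    intro x x' y y' h hx hy
    cases r with
    | nil => simp
    | cons q r =>
      obtain ⟨hp, hs, hr⟩ := isAlignment_cons.1 h
      have h1 := ih _ _ _ _ hr hx hy
      obtain ⟨n, m, e1, e2, _⟩ := cols_proj hr
      rw [show (p :: q :: r).length - 1 = (q :: r).length - 1 + 1 by simp,
        Finset.sum_range_succ']
      simp only [List.getD_cons_succ, List.getD_cons_zero] at h1 ⊢
      rw [Nat.cast_add, pathCost, mul_add, add_comm]
      refine add_le_add ?_ h1
      have two : ∀ c : ℝ≥0, 2 * ((1 / 2 : ℝ≥0) * c) = c := by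
        intro c; rw [← mul_assoc]; simp
      unfold bad
      rcases hs with hs | hs | hs
      · subst hs
        simp only at e1 e2
        rw [if_neg (by simp), if_pos ⟨rfl, rfl⟩, two]
        simpa using hn.2 _ _ (lbl_ne_none (X := X) (i := p.1) (by omega))
      · subst hs
        simp only at e1 e2
        rw [if_neg (by simp), if_neg (by simp), if_pos ⟨rfl, rfl⟩, two]
        simpa using hn.2 _ _ (lbl_ne_none (X := Y) (i := p.2) (by omega)).symm
      · subst hs
        by_cases hl : lbl X p.1 = lbl Y p.2
        · rw [if_pos ⟨rfl, hl⟩]; simp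
        · rw [if_neg (fun e => hl e.2), if_neg (by simp), if_neg (by simp), two]
          simpa using hn.2 _ _ hl

theorem path_step {p : List (ℕ × ℕ)} {x x' y y' : ℕ} (h : IsAlignment x x' y y' p) (t : ℕ)
    (ht : t < p.length - 1) : AlignStep (p.getD t (0, 0)) (p.getD (t + 1) (0, 0)) := by
  have := List.isChain_iff_getElem.1 h.2.2 t (by omega)
  rw [List.getD_eq_getElem _ _ (by omega), List.getD_eq_getElem _ _ (by omega)]
  exact this

theorem walk_of_path {α : Type*} (w : Option α → Option α → ℝ≥0) (hn : Normalized w)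
    {X Y : List (Paren α)} {p : List (ℕ × ℕ)} {k : ℕ}
    (hp : IsAlignment 0 X.length 0 Y.length p) (hc : Consistent X Y p)
    (hk : 2 * pathCost w X Y p < 2 * k + 1) :
    Walk X Y k (p.length - 1) (fun t => (p.getD t (0, 0)).1) (fun t => (p.getD t (0, 0)).2)
      (fun t => ∑ s ∈ Finset.range t, bad X Y (p.getD s (0, 0)) (p.getD (s + 1) (0, 0))) := by
  have hne : p ≠ [] := by rintro rfl; exact not_isAlignment_nil hp
  have hlen : 0 < p.length := List.length_pos_iff.2 hne
  have h0 : p.getD 0 (0, 0) = (0, 0) := by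
    have := hp.1
    rw [List.head?_eq_getElem?] at this
    rw [List.getD_eq_getElem?_getD, this]; rfl
  have hlast : p.getD (p.length - 1) (0, 0) = (X.length, Y.length) := by
    have := hp.2.1
    rw [List.getLast?_eq_getElem?] at this
    rw [List.getD_eq_getElem?_getD, this]; rfl
  have hal : ∀ t, t < p.length → ∀ a, p.getD t (0, 0) = a → p[t]? = some a := by
    intro t ht a ha
    rw [List.getD_eq_getElem _ _ ht] at ha
    rw [List.getElem?_eq_getElem ht, ha]
  refine ⟨?_, ?_, ?_, ?_, ?_, ?_, ?_, ?_⟩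
  · simp only [h0]
  · simp only [h0]
  · simp only [hlast]
  · simp only [hlast]
  · simp
  · have h1 := bad_cost w hn X Y p _ _ _ _ hp le_rfl le_rfl
    have h2 := lt_of_le_of_lt h1 hk
    have h3 : (∑ s ∈ Finset.range (p.length - 1),
        bad X Y (p.getD s (0, 0)) (p.getD (s + 1) (0, 0))) < 2 * k + 1 := by
      exact_mod_cast h2
    omega
  · intro t ht
    simp only [Finset.sum_range_succ]
    have hs := path_step hp t ht
    generalize p.getD t (0, 0) = a at hs ⊢
    generalize p.getD (t + 1) (0, 0) = b at hs ⊢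
    rcases hs with hs | hs | hs
    · subst hs
      left
      simp [bad]
    · subst hs
      right; left
      simp [bad]
    · subst hs
      right; right
      refine ⟨rfl, rfl, by omega, ?_⟩
      intro e
      by_contra hcon
      simp [bad, hcon] at e
  · intro t ht e1 e2 f g hf hg
    obtain ⟨s, s1, s2⟩ := hc _ _ f g ⟨t, hal t (by omega) (_, _) rfl, hal (t + 1) (by omega) _
      (Prod.ext e1 e2)⟩ hf hg
    have hs : s + 1 < p.length := by
      by_contra hcon
      rw [List.getElem?_eq_none (by omega)] at s2
      simp at s2
    refine ⟨s, by omega, ?_, ?_, ?_, ?_⟩ <;> simp [List.getD_eq_getElem?_getD, s1, s2]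

/-- `P` forces a hit. -/
def Forces {α : Type*} (k : ℕ) (P : List (Paren α)) : Prop :=
  ∀ (F1 F2 G1 G2 : List (Paren α)) (n : ℕ) (u v B : ℕ → ℕ),
    F1.length ≤ G1.length + 2 * k → G1.length ≤ F1.length + 2 * k →
    Walk (F1 ++ P ++ F2) (G1 ++ P ++ G2) k n u v B →
    Hit F1.length G1.length P.length n u v

theorem ted_le_of_forces {α : Type*} (w : Option α → Option α → ℝ≥0) (hn : Normalized w)
    (hq : Quasimetric w) {k : ℕ} {P P' F1 F2 G1 G2 : List (Paren α)} (hP : IsForest P)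
    (hP' : IsForest P') (hF : IsForest (F1 ++ P ++ F2)) (hG : IsForest (G1 ++ P ++ G2))
    (l1 : F1.length ≤ G1.length + 2 * k) (l2 : G1.length ≤ F1.length + 2 * k)
    (hf : Forces k P)
    (hle : tedFrag w (F1 ++ P ++ F2) (G1 ++ P ++ G2) 0 (F1 ++ P ++ F2).length 0
      (G1 ++ P ++ G2).length ≤ (k : ℝ≥0∞)) :
    tedFrag w (F1 ++ P' ++ F2) (G1 ++ P' ++ G2) 0 (F1 ++ P' ++ F2).length 0
      (G1 ++ P' ++ G2).length ≤ tedFrag w (F1 ++ P ++ F2) (G1 ++ P ++ G2) 0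
      (F1 ++ P ++ F2).length 0 (G1 ++ P ++ G2).length := by
  by_contra hcon
  rw [not_le] at hcon
  have hlt : tedFrag w (F1 ++ P ++ F2) (G1 ++ P ++ G2) 0 (F1 ++ P ++ F2).length 0
      (G1 ++ P ++ G2).length < min (tedFrag w (F1 ++ P' ++ F2) (G1 ++ P' ++ G2) 0
      (F1 ++ P' ++ F2).length 0 (G1 ++ P' ++ G2).length) (((k : ℝ≥0) + 1 / 2 : ℝ≥0) : ℝ≥0∞) := by
    refine lt_min hcon (lt_of_le_of_lt hle ?_)
    rw [← ENNReal.coe_natCast, ENNReal.coe_lt_coe]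
    simp
  conv at hlt => lhs; unfold tedFrag
  rw [iInf_lt_iff] at hlt
  obtain ⟨⟨p, hp, hc⟩, h⟩ := hlt
  simp only at h
  obtain ⟨h1, h2⟩ := lt_min_iff.1 h
  rw [ENNReal.coe_lt_coe] at h2
  have h3 : 2 * pathCost w (F1 ++ P ++ F2) (G1 ++ P ++ G2) p < 2 * k + 1 := by
    calc 2 * pathCost w (F1 ++ P ++ F2) (G1 ++ P ++ G2) p
        < 2 * ((k : ℝ≥0) + 1 / 2) := mul_lt_mul_of_pos_left h2 (by norm_num)
      _ = 2 * k + 1 := by rw [mul_add]; simp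
  have W := walk_of_path w hn hp hc h3
  obtain ⟨t, ht, c, hcN, hu, hv⟩ := hf F1 F2 G1 G2 _ _ _ _ l1 l2 W
  have hne : p ≠ [] := by rintro rfl; exact not_isAlignment_nil hp
  have hlen : 0 < p.length := List.length_pos_iff.2 hne
  have hmem : (F1.length + c, G1.length + c) ∈ p := by
    have : p.getD t (0, 0) = (F1.length + c, G1.length + c) := Prod.ext hu hv
    rw [List.getD_eq_getElem _ _ (by omega)] at this
    rw [← this]; exact List.getElem_mem _
  obtain ⟨p', a1, a2, a3⟩ := transfer w hn hq hP hP' hF hG hp hc hcN hmem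
  have h4 : tedFrag w (F1 ++ P' ++ F2) (G1 ++ P' ++ G2) 0 (F1 ++ P' ++ F2).length 0
      (G1 ++ P' ++ G2).length ≤ (pathCost w (F1 ++ P' ++ F2) (G1 ++ P' ++ G2) p' : ℝ≥0∞) := by
    unfold tedFrag
    exact iInf_le_of_le ⟨p', a1, a2⟩ le_rfl
  exact absurd (lt_of_lt_of_le h1 h4) (not_lt.2 (ENNReal.coe_le_coe.2 a3))

theorem equiv_of_forces {α : Type*} (w : Option α → Option α → ℝ≥0) (hn : Normalized w)
    (hq : Quasimetric w) {k : ℕ} {P P' : List (Paren α)} (hP : IsForest P)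
    (hP' : IsForest P') (hf : Forces k P) (hf' : Forces k P') : ForestEquiv k w P P' := by
  intro F1 F2 G1 G2 hF hG l1 l2
  have hF' : IsForest (F1 ++ P' ++ F2) := (forest_remove hP' _ _).2 ((forest_remove hP _ _).1 hF)
  have hG' : IsForest (G1 ++ P' ++ G2) := (forest_remove hP' _ _).2 ((forest_remove hP _ _).1 hG)
  have i1 := ted_le_of_forces w hn hq hP hP' hF hG l1 l2 hf
  have i2 := ted_le_of_forces w hn hq hP' hP hF' hG' l1 l2 hf'
  unfold tedLE
  split_ifs with c1 c2 c2
  · exact le_antisymm (i2 c2) (i1 c1)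
  · exact absurd ((i1 c1).trans c1) c2
  · exact absurd ((i2 c2).trans c2) c1
  · rfl

theorem forest_reduction {α : Type*} (k : ℕ) (hk : 0 < k)
    (P : List (Paren α)) (hP : IsForest P) :
    ∃ P' : List (Paren α), IsForest P' ∧ P'.length ≤ P.length ∧
      redCount k P' ≤ 158 * k ^ 2 ∧
      ∀ w : Option α → Option α → ℝ≥0, Normalized w → Quasimetric w →
        ForestEquiv k w P P' := by
  by_cases hred : redCount k P ≤ 158 * k ^ 2
  · exact ⟨P, hP, le_rfl, hred, fun w _ _ F1 F2 G1 G2 _ _ _ _ => rfl⟩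
  · rw [not_le] at hred
    have hcard : ∀ T : List (Paren α), redCount k T ≤ T.length := by
      intro T
      exact (Finset.card_filter_le _ _).trans (by simp)
    have hlen := hcard P
    have hkk : 14 * k ≤ 158 * k ^ 2 := by nlinarith
    obtain ⟨c, hc⟩ := List.exists_mem_of_length_pos (l := P) (by omega)
    have hl := spine_length c.2 (7 * k)
    have hr := hcard (spine c.2 (7 * k))
    refine ⟨spine c.2 (7 * k), spine_forest _ _, by omega, by omega, fun w hn hq => ?_⟩
    exact equiv_of_forces w hn hq hP (spine_forest _ _) (forcing_red hP (by omega) hred)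
      (forcing_spine c.2 (by omega))
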